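/- If u is a strong solution of ∂_t u = (1/2) u ∂_x² u on a time interval [0,T̄) whose initial data u(0,·) is smooth (infinitely differentiable) and compactly supported on ℝ, then u is infinitely differentiable on [0,T̄) × ℝ. -/

import Mathlib

open MeasureTheory Set Filter

noncomputable section

/-- Regularity requirements in the definition of a weak solution of
`∂ₜ u = (1/2) u ∂ₓ² u` on `[0,T) × ℝ`: continuity on `[0,T) × ℝ`, local Lipschitz
continuity of `u(t,·)`, and continuity of `t ↦ u(t,·)` into `W^{1,∞}_loc(ℝ)`. -/
def RegWeak (T : ℝ) (u : ℝ → ℝ → ℝ) : Prop :=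
  ContinuousOn (Function.uncurry u) (Ico 0 T ×ˢ (univ : Set ℝ)) ∧
  (∀ t ∈ Ico (0:ℝ) T, ∀ R : ℝ, 0 < R →
    ∃ L : NNReal, LipschitzOnWith L (u t) (Icc (-R) R)) ∧
  (∀ t₀ ∈ Ico (0:ℝ) T, ∀ R : ℝ, 0 < R →
    Tendsto (fun t => ⨆ x : Icc (-R) R,
        (|u t x.1 - u t₀ x.1| + |deriv (u t) x.1 - deriv (u t₀) x.1|))
      (nhdsWithin t₀ (Ico 0 T)) (nhds 0))

/-- The weak (integral) formulation of `∂ₜ u = (1/2) u ∂ₓ² u` on `[0,T) × ℝ`,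
tested against every `ψ ∈ C_c^∞([0,T) × ℝ)`. -/
def WeakForm (T : ℝ) (u : ℝ → ℝ → ℝ) : Prop :=
  ∀ ψ : ℝ → ℝ → ℝ,
    ContDiff ℝ (⊤ : ℕ∞) (Function.uncurry ψ) →
    HasCompactSupport (Function.uncurry ψ) →
    tsupport (Function.uncurry ψ) ⊆ Iio T ×ˢ (univ : Set ℝ) →
    (∫ x : ℝ, u 0 x * ψ 0 x) +
      (∫ t in Ico (0:ℝ) T, ∫ x : ℝ,
        (u t x * deriv (fun s => ψ s x) t
          - (1/2) * deriv (fun y => ψ t y * u t y) x * deriv (u t) x)) = 0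

/-- A weak solution of `∂ₜ u = (1/2) u ∂ₓ² u` on `[0,T) × ℝ`. -/
def IsWeakSolution (T : ℝ) (u : ℝ → ℝ → ℝ) : Prop :=
  (∀ t ∈ Ico (0:ℝ) T, ∀ x : ℝ, 0 ≤ u t x) ∧ RegWeak T u ∧ WeakForm T u

/-- `sup_{[0,T']×ℝ} ⟨x⟩⁻² u < ∞`, i.e. `u(t,x) ≤ M (x²+1)` on `[0,T'] × ℝ`. -/
def QuadBoundOn (u : ℝ → ℝ → ℝ) (T' : ℝ) : Prop :=
  ∃ M : ℝ, ∀ t ∈ Icc (0:ℝ) T', ∀ x : ℝ, u t x ≤ M * (x ^ 2 + 1)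

/-- For a.e. `t ∈ (0,T']` the function `u(t,·)` is twice differentiable, and
`t ↦ ess sup_x |∂ₓ² u(t,x)|` is integrable on `[0,T']` (expressed via an
integrable majorant `g`). -/
def SecondDerivIntegrableOn (u : ℝ → ℝ → ℝ) (T' : ℝ) : Prop :=
  ∃ g : ℝ → ℝ, IntegrableOn g (Icc (0:ℝ) T') ∧
    ∀ᵐ t ∂(volume.restrict (Ioc (0:ℝ) T')),
      (∀ x : ℝ, DifferentiableAt ℝ (u t) x ∧ DifferentiableAt ℝ (deriv (u t)) x) ∧
      (∀ x : ℝ, |deriv (deriv (u t)) x| ≤ g t)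

/-- A strong solution of `∂ₜ u = (1/2) u ∂ₓ² u` on `[0,T) × ℝ`. -/
def IsStrongSolution (T : ℝ) (u : ℝ → ℝ → ℝ) : Prop :=
  IsWeakSolution T u ∧
  ∀ T' : ℝ, 0 < T' → T' < T → QuadBoundOn u T' ∧ SecondDerivIntegrableOn u T'

section Auxiliary

open scoped Topology

/-- A finite family of functions which starts below a barrier and cannot cross it stays below. -/
theorem finset_le_of_barrier {ι : Type*} (s : Finset ι) {a b : ℝ} {f f' : ι → ℝ → ℝ} {B B' : ℝ → ℝ}
    (hf : ∀ j ∈ s, ∀ t ∈ Icc a b, HasDerivWithinAt (f j) (f' j t) (Icc a b) t)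
    (hB : ∀ t ∈ Icc a b, HasDerivWithinAt B (B' t) (Icc a b) t)
    (h0 : ∀ j ∈ s, f j a ≤ B a)
    (hlt : ∀ t ∈ Icc a b, (∀ k ∈ s, f k t ≤ B t) → ∀ j ∈ s, f j t = B t → f' j t < B' t) :
    ∀ t ∈ Icc a b, ∀ j ∈ s, f j t ≤ B t := by
  have hcl : IsClosed ({t | ∀ j ∈ s, f j t ≤ B t} ∩ Icc a b) := by
    have : {t | ∀ j ∈ s, f j t ≤ B t} ∩ Icc a b
        = Icc a b ∩ ⋂ j ∈ s, {t | t ∈ Icc a b ∧ f j t ≤ B t} := by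
      ext t
      simp only [mem_inter_iff, mem_ofPred_eq, mem_iInter]
      constructor
      · rintro ⟨h1, h2⟩
        exact ⟨h2, fun j hj => ⟨h2, h1 j hj⟩⟩
      · rintro ⟨h1, h2⟩
        exact ⟨fun j hj => (h2 j hj).2, h1⟩
    rw [this]
    refine isClosed_Icc.inter (isClosed_biInter fun j hj => ?_)
    exact isClosed_Icc.isClosed_le (fun t ht => (hf j hj t ht).continuousWithinAt)
      (fun t ht => (hB t ht).continuousWithinAt)
  intro t ht
  refine IsClosed.Icc_subset_of_forall_exists_gt hcl h0 ?_ ht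
  rintro x ⟨hx, hxI⟩ y hy
  have hxI' : x ∈ Icc a b := Ico_subset_Icc_self hxI
  have hsub : Icc a b ∈ 𝓝[>] x := by
    refine mem_of_superset (Ioc_mem_nhdsGT hxI.2) ?_
    exact fun z hz => ⟨hxI.1.trans hz.1.le, hz.2⟩
  have key : ∀ j ∈ s, ∀ᶠ z in 𝓝[>] x, f j z ≤ B z := by
    intro j hj
    have hd : HasDerivWithinAt (fun z => B z - f j z) (B' x - f' j x) (Ioi x) x :=
      ((hB x hxI').sub (hf j hj x hxI')).mono_of_mem_nhdsWithin hsub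
    rcases (hx j hj).lt_or_eq with h | h
    · have : Tendsto (fun z => B z - f j z) (𝓝[>] x) (𝓝 (B x - f j x)) := hd.continuousWithinAt
      filter_upwards [this.eventually (lt_mem_nhds (sub_pos.2 h))] with z hz
      linarith
    · have h1 := hlt x hxI' hx j hj h
      have h2 := (hasDerivWithinAt_iff_tendsto_slope' (by simp)).1 hd
      filter_upwards [h2.eventually (lt_mem_nhds (sub_pos.2 h1)), self_mem_nhdsWithin] with z hz hxz
      rw [slope_def_field] at hz
      have : 0 < z - x := sub_pos.2 hxz
      have := (div_pos_iff_of_pos_right this).1 hz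
      linarith
  have hall : ∀ᶠ z in 𝓝[>] x, ∀ j ∈ s, f j z ≤ B z := (Finset.eventually_all s).2 key
  obtain ⟨z, hz1, hz2⟩ := (hall.and (eventually_mem_set.2 (Ioc_mem_nhdsGT hy))).exists
  exact ⟨z, hz1, hz2⟩

/-- Truncation of a real number to `[0, M]`. -/
def trunc (M r : ℝ) : ℝ := max 0 (min r M)

lemma trunc_nonneg (M r : ℝ) : 0 ≤ trunc M r := le_max_left _ _

lemma trunc_le {M : ℝ} (hM : 0 ≤ M) (r : ℝ) : trunc M r ≤ M := max_le hM (min_le_right _ _)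

lemma trunc_of_mem {M r : ℝ} (h0 : 0 ≤ r) (h1 : r ≤ M) : trunc M r = r := by
  simp [trunc, h0, h1]

lemma trunc_of_ge {M r : ℝ} (hM : 0 ≤ M) (h1 : M ≤ r) : trunc M r = M := by
  simp [trunc, h1, hM]

lemma trunc_of_nonpos {M r : ℝ} (h1 : r ≤ 0) : trunc M r = 0 := by
  simp only [trunc]
  exact max_eq_left ((min_le_left _ _).trans h1)

lemma abs_trunc_sub_le (M r s : ℝ) : |trunc M r - trunc M s| ≤ |r - s| := by
  unfold trunc
  refine (abs_max_sub_max_le_max 0 (min r M) 0 (min s M)).trans ?_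
  simp only [sub_self, abs_zero]
  refine max_le (abs_nonneg _) ((abs_min_sub_min_le_max r M s M).trans ?_)
  simp

/-- The forward difference quotient with step `h` of a sequence. -/
def fdq (h : ℝ) (a : ℤ → ℝ) : ℤ → ℝ := fun i => (a (i + 1) - a i) / h

/-- Solutions on `[0, τ]` of the spatially discretized equation with mesh `h`. -/
def IsLatticeSol (h τ : ℝ) (z : ℝ → ℤ → ℝ) : Prop :=
  ∀ t ∈ Icc 0 τ, ∀ i, HasDerivWithinAt (fun s => z s i)
    (z t i * (z t (i + 1) - 2 * z t i + z t (i - 1)) / (2 * h ^ 2)) (Icc 0 τ) t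

section Existence

variable (s : Finset ℤ)

/-- Extension by zero of a function on a finite set of integers. -/
def extendZero (v : s → ℝ) (i : ℤ) : ℝ := if hi : i ∈ s then v ⟨i, hi⟩ else 0

lemma abs_extendZero_sub_le (v w : s → ℝ) (i : ℤ) :
    |extendZero s v i - extendZero s w i| ≤ ‖v - w‖ := by
  unfold extendZero
  split_ifs with hi
  · exact norm_le_pi_norm (v - w) ⟨i, hi⟩
  · simp

/-- The truncated lattice vector field. -/
def latticeField (h M : ℝ) (v : s → ℝ) : s → ℝ := fun i =>
  trunc M (extendZero s v i) * (trunc M (extendZero s v (i + 1)) - 2 * trunc M (extendZero s v i)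
    + trunc M (extendZero s v (i - 1))) / (2 * h ^ 2)

lemma exists_truncated_solution {h M τ : ℝ} (hh : 0 < h) (hM : 0 ≤ M) (hτ : 0 ≤ τ) (v₀ : s → ℝ) :
    ∃ v : ℝ → s → ℝ, v 0 = v₀ ∧ ∀ t ∈ Icc 0 τ,
      HasDerivWithinAt v (latticeField s h M (v t)) (Icc 0 τ) t := by
  have hh2 : 0 < 2 * h ^ 2 := by positivity
  have hT := trunc_nonneg M
  have hT' := trunc_le hM
  have hbd : ∀ v : s → ℝ, ‖latticeField s h M v‖ ≤ 4 * M ^ 2 / (2 * h ^ 2) := by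
    intro v
    refine (pi_norm_le_iff_of_nonneg (by positivity)).2 fun i => ?_
    rw [latticeField, Real.norm_eq_abs, abs_div, abs_of_pos hh2, abs_mul]
    refine div_le_div_of_nonneg_right ?_ hh2.le
    have h1 : |trunc M (extendZero s v i)| ≤ M := by rw [abs_of_nonneg (hT _)]; exact hT' _
    have h2 : |trunc M (extendZero s v (i + 1)) - 2 * trunc M (extendZero s v i)
        + trunc M (extendZero s v (i - 1))| ≤ 4 * M := by
      rw [abs_le]
      constructor <;> linarith [hT (extendZero s v i), hT (extendZero s v (i + 1)),
        hT (extendZero s v (i - 1)), hT' (extendZero s v i), hT' (extendZero s v (i + 1)),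
        hT' (extendZero s v (i - 1))]
    calc _ ≤ M * (4 * M) := mul_le_mul h1 h2 (abs_nonneg _) hM
      _ = _ := by ring
  have hlip : ∀ v w : s → ℝ, ‖latticeField s h M v - latticeField s h M w‖
      ≤ 8 * M / (2 * h ^ 2) * ‖v - w‖ := by
    intro v w
    refine (pi_norm_le_iff_of_nonneg (by positivity)).2 fun i => ?_
    have key : ∀ j, |trunc M (extendZero s v j) - trunc M (extendZero s w j)| ≤ ‖v - w‖ :=
      fun j => (abs_trunc_sub_le M _ _).trans (abs_extendZero_sub_le s v w j)
    rw [Pi.sub_apply, latticeField, latticeField, Real.norm_eq_abs, ← sub_div, abs_div,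
      abs_of_pos hh2, div_mul_eq_mul_div]
    refine div_le_div_of_nonneg_right ?_ hh2.le
    have k0 := key i
    have k1 := key (i + 1)
    have k2 := key (i - 1)
    set a := trunc M (extendZero s v i)
    set b := trunc M (extendZero s v (i + 1))
    set c := trunc M (extendZero s v (i - 1))
    set a' := trunc M (extendZero s w i)
    set b' := trunc M (extendZero s w (i + 1))
    set c' := trunc M (extendZero s w (i - 1))
    have e : a * (b - 2 * a + c) - a' * (b' - 2 * a' + c')
        = a * ((b - b') - 2 * (a - a') + (c - c')) + (a - a') * (b' - 2 * a' + c') := by ring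
    have e1 : |(b - b') - 2 * (a - a') + (c - c')| ≤ 4 * ‖v - w‖ := by
      rw [abs_le] at *
      constructor <;> linarith
    have e2 : |b' - 2 * a' + c'| ≤ 4 * M := by
      rw [abs_le]
      constructor <;> linarith [hT (extendZero s w i), hT (extendZero s w (i + 1)),
        hT (extendZero s w (i - 1)), hT' (extendZero s w i), hT' (extendZero s w (i + 1)),
        hT' (extendZero s w (i - 1))]
    have e3 : |a| ≤ M := by rw [abs_of_nonneg (hT _)]; exact hT' _
    rw [e]
    calc _ ≤ |a| * |(b - b') - 2 * (a - a') + (c - c')| + |a - a'| * |b' - 2 * a' + c'| := by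
            rw [← abs_mul, ← abs_mul]; exact abs_add_le _ _
      _ ≤ M * (4 * ‖v - w‖) + ‖v - w‖ * (4 * M) := by gcongr
      _ = _ := by ring
  have hPL : IsPicardLindelof (fun _ : ℝ => latticeField s h M) (tmin := 0) (tmax := τ)
      ⟨0, left_mem_Icc.2 hτ⟩ v₀ (Real.toNNReal (4 * M ^ 2 / (2 * h ^ 2) * τ)) 0
      (Real.toNNReal (4 * M ^ 2 / (2 * h ^ 2))) (Real.toNNReal (8 * M / (2 * h ^ 2))) := by
    refine ⟨fun t _ => ?_, fun x _ => continuousOn_const, fun t _ x _ => ?_, ?_⟩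
    · refine LipschitzWith.lipschitzOnWith (LipschitzWith.of_dist_le_mul fun v w => ?_)
      rw [dist_eq_norm, dist_eq_norm, Real.coe_toNNReal _ (by positivity)]
      exact hlip v w
    · rw [Real.coe_toNNReal _ (by positivity)]
      exact hbd x
    · rw [Real.coe_toNNReal _ (by positivity), Real.coe_toNNReal _ (by positivity)]
      simp [hτ]
  obtain ⟨v, hv, hv'⟩ := hPL.exists_eq_forall_mem_Icc_hasDerivWithinAt₀
  exact ⟨v, hv, hv'⟩

end Existence

/-- Existence for the spatially discretized equation, with finitely supported initial data. -/
theorem exists_latticeSol {h M τ : ℝ} (hh : 0 < h) (hM : 0 ≤ M) (hτ : 0 ≤ τ) (s : Finset ℤ)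
    (a : ℤ → ℝ) (has : ∀ i, i ∉ s → a i = 0) (ha0 : ∀ i, 0 ≤ a i) (haM : ∀ i, a i ≤ M) :
    ∃ z : ℝ → ℤ → ℝ, z 0 = a ∧ (∀ t i, i ∉ s → z t i = 0) ∧
      (∀ t ∈ Icc 0 τ, ∀ i, 0 ≤ z t i ∧ z t i ≤ M) ∧ IsLatticeSol h τ z := by
  obtain ⟨v, hv0, hv⟩ := exists_truncated_solution s hh hM hτ (fun i => a i)
  have hh2 : 0 < 2 * h ^ 2 := by positivity
  set z : ℝ → ℤ → ℝ := fun t => extendZero s (v t) with hz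
  have hzs : ∀ t i, i ∉ s → z t i = 0 := fun t i hi => by simp [hz, extendZero, hi]
  have hz0 : z 0 = a := by
    ext i
    by_cases hi : i ∈ s
    · simp [hz, extendZero, hi, hv0]
    · simp [hzs 0 i hi, has i hi]
  set F : ℤ → ℝ → ℝ := fun i t => trunc M (z t i) * (trunc M (z t (i + 1))
    - 2 * trunc M (z t i) + trunc M (z t (i - 1))) / (2 * h ^ 2) with hF
  have hzd : ∀ i, ∀ t ∈ Icc 0 τ, HasDerivWithinAt (fun r => z r i) (F i t) (Icc 0 τ) t := by
    intro i t ht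
    by_cases hi : i ∈ s
    · have := (hasDerivWithinAt_pi.1 (hv t ht)) ⟨i, hi⟩
      refine this.congr_of_eventuallyEq ?_ ?_
      · exact Eventually.of_forall fun r => by simp [hz, extendZero, hi]
      · simp [hz, extendZero, hi]
    · have h1 : F i t = 0 := by simp [hF, hzs t i hi, trunc_of_nonpos]
      have h2 : (fun r => z r i) = fun _ => 0 := funext fun r => hzs r i hi
      rw [h1, h2]
      exact hasDerivWithinAt_const _ _ _
  have hup : ∀ t ∈ Icc 0 τ, ∀ i, z t i ≤ M := by
    intro t ht i
    refine le_of_forall_pos_le_add fun ε hε => ?_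
    by_cases hi : i ∈ s
    swap
    · rw [hzs t i hi]; positivity
    have := finset_le_of_barrier (a := 0) (b := τ) s (f := fun i r => z r i) (f' := F)
      (B := fun r => M + ε / (1 + τ) * (1 + r)) (B' := fun r => ε / (1 + τ))
      (fun j _ t ht => hzd j t ht) (fun t _ => by
        simpa using (((hasDerivAt_id t).const_add 1).const_mul (ε / (1 + τ))).const_add M
          |>.hasDerivWithinAt) (fun j _ => by
        have := haM j
        simp only [hz0]
        have : 0 ≤ ε / (1 + τ) * (1 + 0) := by positivity
        linarith) (fun r hr hk j hj he => by
        have hr0 := hr.1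
        have hge : M ≤ z r j := by
          rw [he]
          have : 0 ≤ ε / (1 + τ) * (1 + r) := by positivity
          linarith
        have hFle : F j r ≤ 0 := by
          simp only [hF, trunc_of_ge hM hge]
          refine div_nonpos_of_nonpos_of_nonneg ?_ hh2.le
          refine mul_nonpos_of_nonneg_of_nonpos hM ?_
          linarith [trunc_le hM (z r (j + 1)), trunc_le hM (z r (j - 1))]
        exact hFle.trans_lt (by positivity)) t ht i hi
    refine this.trans ?_
    have h1 : ε / (1 + τ) * (1 + t) ≤ ε := by
      rw [div_mul_eq_mul_div, div_le_iff₀ (by positivity)]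
      gcongr
      exact ht.2
    linarith
  have hlo : ∀ t ∈ Icc 0 τ, ∀ i, 0 ≤ z t i := by
    intro t ht i
    refine le_of_forall_pos_le_add fun ε hε => ?_
    by_cases hi : i ∈ s
    swap
    · rw [hzs t i hi]; positivity
    have := finset_le_of_barrier (a := 0) (b := τ) s (f := fun i r => - z r i)
      (f' := fun i r => - F i r)
      (B := fun r => ε / (1 + τ) * (1 + r)) (B' := fun r => ε / (1 + τ))
      (fun j _ t ht => (hzd j t ht).neg) (fun t _ => by
        simpa using (((hasDerivAt_id t).const_add 1).const_mul (ε / (1 + τ)))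
          |>.hasDerivWithinAt) (fun j _ => by
        have := ha0 j
        simp only [hz0]
        have : 0 ≤ ε / (1 + τ) * (1 + 0) := by positivity
        linarith) (fun r hr hk j hj he => by
        have hr0 := hr.1
        have hge : z r j ≤ 0 := by
          have : 0 ≤ ε / (1 + τ) * (1 + r) := by positivity
          linarith
        have hFle : F j r = 0 := by
          simp only [hF, trunc_of_nonpos hge]
          simp
        rw [hFle, neg_zero]
        positivity) t ht i hi
    have h1 : ε / (1 + τ) * (1 + t) ≤ ε := by
      rw [div_mul_eq_mul_div, div_le_iff₀ (by positivity)]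
      gcongr
      exact ht.2
    linarith
  refine ⟨z, hz0, hzs, fun t ht i => ⟨hlo t ht i, hup t ht i⟩, fun t ht i => ?_⟩
  have := hzd i t ht
  simp only [hF] at this
  rwa [trunc_of_mem (hlo t ht i) (hup t ht i), trunc_of_mem (hlo t ht _) (hup t ht _),
    trunc_of_mem (hlo t ht (i - 1)) (hup t ht _)] at this

section Differences

variable {h : ℝ}

lemma fdq_iterate_succ (n : ℕ) (a : ℤ → ℝ) (i : ℤ) :
    (fdq h)^[n + 1] a i = ((fdq h)^[n] a (i + 1) - (fdq h)^[n] a i) / h := by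
  rw [Function.iterate_succ_apply', fdq]

lemma fdq_iterate_shift (n : ℕ) (a : ℤ → ℝ) (c i : ℤ) :
    (fdq h)^[n] (fun j => a (j + c)) i = (fdq h)^[n] a (i + c) := by
  induction n generalizing i with
  | zero => rfl
  | succ n ih => rw [fdq_iterate_succ, fdq_iterate_succ, ih, ih, add_right_comm]

lemma fdq_iterate_const_mul (n : ℕ) (c : ℝ) (a : ℤ → ℝ) (i : ℤ) :
    (fdq h)^[n] (fun j => c * a j) i = c * (fdq h)^[n] a i := by
  induction n generalizing i with
  | zero => rfl
  | succ n ih => rw [fdq_iterate_succ, fdq_iterate_succ, ih, ih, ← mul_sub, mul_div_assoc]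

/-- The Leibniz rule for iterated difference quotients. -/
lemma fdq_iterate_mul (n : ℕ) (f g : ℤ → ℝ) (i : ℤ) :
    (fdq h)^[n] (fun j => f j * g j) i =
      ∑ k ∈ Finset.range (n + 1),
        (n.choose k : ℝ) * ((fdq h)^[k] f i * (fdq h)^[n - k] g (i + k)) := by
  induction n generalizing i with
  | zero => simp
  | succ n ih =>
    rw [Finset.sum_choose_succ_mul (fun k l => (fdq h)^[k] f i * (fdq h)^[l] g (i + k)),
      fdq_iterate_succ, ih, ih, ← Finset.sum_sub_distrib, ← Finset.sum_add_distrib,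
      Finset.sum_div]
    refine Finset.sum_congr rfl fun k hk => ?_
    have hk' : k ≤ n := Nat.lt_succ_iff.1 (Finset.mem_range.1 hk)
    rw [Nat.succ_sub hk', fdq_iterate_succ (n - k), fdq_iterate_succ k]
    push_cast
    rw [show i + 1 + (k : ℤ) = i + k + 1 by ring, show i + ((k : ℤ) + 1) = i + k + 1 by ring]
    ring

lemma fdq_iterate_hasDerivWithinAt (n : ℕ) {z : ℝ → ℤ → ℝ} {f : ℤ → ℝ} {s : Set ℝ} {t : ℝ}
    (H : ∀ i, HasDerivWithinAt (fun r => z r i) (f i) s t) (i : ℤ) :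
    HasDerivWithinAt (fun r => (fdq h)^[n] (z r) i) ((fdq h)^[n] f i) s t := by
  induction n generalizing i with
  | zero => exact H i
  | succ n ih =>
    simp only [fdq_iterate_succ]
    exact ((ih (i + 1)).sub (ih i)).div_const h

lemma abs_sub_le_of_abs_fdq_le (hh : 0 < h) {a : ℤ → ℝ} {C : ℝ} (H : ∀ i, |fdq h a i| ≤ C)
    (i j : ℤ) : |a j - a i| ≤ C * |(j - i) * h| := by
  have hC : 0 ≤ C := (abs_nonneg _).trans (H 0)
  have hstep : ∀ i, |a (i + 1) - a i| ≤ C * h := by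
    intro i
    have := H i
    rwa [fdq, abs_div, abs_of_pos hh, div_le_iff₀ hh] at this
  have key : ∀ (k : ℕ) (i : ℤ), |a (i + k) - a i| ≤ C * (k * h) := by
    intro k
    induction k with
    | zero => intro i; simp
    | succ k ih =>
      intro i
      have h1 := ih i
      have h2 := hstep (i + k)
      have e : a (i + (k + 1 : ℕ)) - a i = (a (i + k + 1) - a (i + k)) + (a (i + k) - a i) := by
        push_cast
        rw [add_assoc]
        ring
      rw [e]
      refine (abs_add_le _ _).trans ?_
      push_cast
      linarith
  rcases le_total i j with hij | hij
  · obtain ⟨k, hk⟩ := Int.eq_ofNat_of_zero_le (sub_nonneg.2 hij)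
    have e : j = i + k := by omega
    have := key k i
    subst e
    push_cast
    rwa [add_sub_cancel_left, abs_of_nonneg (a := (k : ℝ) * h) (by positivity)]
  · obtain ⟨k, hk⟩ := Int.eq_ofNat_of_zero_le (sub_nonneg.2 hij)
    have e : i = j + k := by omega
    have := key k j
    subst e
    push_cast
    rw [abs_sub_comm, abs_mul, abs_of_pos hh]
    rwa [sub_add_cancel_left, abs_neg, abs_of_nonneg (a := (k : ℝ)) (by positivity)]

/-- A first-order Taylor estimate for sequences. -/
lemma abs_taylor_le_of_abs_fdq_le (hh : 0 < h) {a : ℤ → ℝ} {C : ℝ}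
    (H : ∀ i, |fdq h (fdq h a) i| ≤ C) (i j : ℤ) :
    |a j - a i - (j - i) * h * fdq h a i| ≤ C * ((j - i) * h) ^ 2 := by
  have hC : 0 ≤ C := (abs_nonneg _).trans (H 0)
  have hlip := abs_sub_le_of_abs_fdq_le hh H
  have hst : ∀ i, a (i + 1) = a i + h * fdq h a i := by
    intro i
    rw [fdq]
    field_simp
    ring
  have key : ∀ (k : ℕ), |a (i + k) - a i - k * h * fdq h a i| ≤ C * (k * h) ^ 2 := by
    intro k
    induction k with
    | zero => simp
    | succ k ih =>
      have h2 := hlip i (i + k)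
      push_cast at h2
      rw [add_sub_cancel_left, abs_of_nonneg (a := (k : ℝ) * h) (by positivity)] at h2
      have e : a (i + (k + 1 : ℕ)) - a i - (k + 1 : ℕ) * h * fdq h a i
          = (a (i + k) - a i - k * h * fdq h a i) + h * (fdq h a (i + k) - fdq h a i) := by
        push_cast
        rw [← add_assoc, hst]
        ring
      rw [e]
      refine (abs_add_le _ _).trans ?_
      rw [abs_mul, abs_of_pos hh]
      calc _ ≤ C * (k * h) ^ 2 + h * (C * (k * h)) := by gcongr
        _ ≤ C * (k * h) ^ 2 + h * (C * (k * h)) + C * h ^ 2 * (k + 1) := by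
          have : 0 ≤ C * h ^ 2 * (k + 1) := by positivity
          linarith
        _ = _ := by push_cast; ring
  have key' : ∀ (k : ℕ), |a (i - k) - a i + k * h * fdq h a i| ≤ C * (k * h) ^ 2 := by
    intro k
    induction k with
    | zero => simp
    | succ k ih =>
      have h2 := hlip i (i - (k + 1))
      push_cast at h2
      rw [show ((i : ℝ) - (k + 1) - i) * h = -((k + 1) * h) by ring, abs_neg,
        abs_of_nonneg (a := ((k : ℝ) + 1) * h) (by positivity)] at h2
      have e : a (i - (k + 1 : ℕ)) - a i + (k + 1 : ℕ) * h * fdq h a i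
          = (a (i - k) - a i + k * h * fdq h a i)
            + (-h) * (fdq h a (i - (k + 1)) - fdq h a i) := by
        have := hst (i - (k + 1))
        rw [show i - ((k : ℤ) + 1) + 1 = i - k by ring] at this
        rw [this]
        push_cast
        ring
      rw [e]
      refine (abs_add_le _ _).trans ?_
      rw [abs_mul, abs_neg, abs_of_pos hh]
      calc _ ≤ C * (k * h) ^ 2 + h * (C * ((k + 1) * h)) := by gcongr
        _ ≤ C * (k * h) ^ 2 + h * (C * ((k + 1) * h)) + C * h ^ 2 * k := by
          have : 0 ≤ C * h ^ 2 * k := by positivity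
          linarith
        _ = _ := by push_cast; ring
  rcases le_total i j with hij | hij
  · obtain ⟨k, hk⟩ := Int.eq_ofNat_of_zero_le (sub_nonneg.2 hij)
    have e : j = i + k := by omega
    have := key k
    subst e
    push_cast
    rwa [add_sub_cancel_left]
  · obtain ⟨k, hk⟩ := Int.eq_ofNat_of_zero_le (sub_nonneg.2 hij)
    have e : j = i - k := by omega
    have := key' k
    subst e
    push_cast
    convert this using 2 <;> ring

lemma abs_fdq_iterate_le_of_abs_iteratedDeriv_le (hh : 0 < h) (n : ℕ) {f : ℝ → ℝ} {C : ℝ}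
    (hf : ContDiff ℝ n f) (hC : ∀ x, |iteratedDeriv n f x| ≤ C) (i : ℤ) :
    |(fdq h)^[n] (fun j : ℤ => f (j * h)) i| ≤ C := by
  induction n generalizing f C i with
  | zero => simpa using hC (i * h)
  | succ n ih =>
    rw [Function.iterate_succ_apply]
    have hf' : ContDiff ℝ n f := hf.of_le (by exact_mod_cast n.le_succ)
    set g : ℝ → ℝ := fun x => h⁻¹ * (f (x + h) - f x) with hg
    have e : fdq h (fun j : ℤ => f (j * h)) = fun j : ℤ => g (j * h) := by
      ext j
      simp only [fdq, hg]
      push_cast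
      rw [add_mul, one_mul]
      ring
    rw [e]
    have hsh : ContDiff ℝ n (fun x => f (x + h)) :=
      hf'.comp (contDiff_id.add contDiff_const)
    have hgc : ContDiff ℝ n g := contDiff_const.mul (hsh.sub hf')
    refine ih hgc (fun x => ?_) i
    have hgd : iteratedDeriv n g x
        = h⁻¹ * (iteratedDeriv n f (x + h) - iteratedDeriv n f x) := by
      rw [hg, iteratedDeriv_const_mul_field, iteratedDeriv_fun_sub hsh.contDiffAt hf'.contDiffAt,
        iteratedDeriv_comp_add_const]
    have hdiff : Differentiable ℝ (iteratedDeriv n f) :=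
      hf.differentiable_iteratedDeriv n (by exact_mod_cast n.lt_succ_self)
    have hmv := convex_univ.norm_image_sub_le_of_norm_deriv_le (f := iteratedDeriv n f) (C := C)
      (fun y _ => hdiff y) (fun y _ => by
        rw [← iteratedDeriv_succ]; exact hC y) (mem_univ x) (mem_univ (x + h))
    rw [add_sub_cancel_left, Real.norm_eq_abs, Real.norm_eq_abs, abs_of_pos hh] at hmv
    rw [hgd, abs_mul, abs_of_pos (inv_pos.2 hh), inv_mul_le_iff₀ hh, mul_comm h]
    exact hmv

/-- The time derivative of the `n`-th difference quotient along the lattice equation. -/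
def latticeRate (h : ℝ) (n : ℕ) (z : ℤ → ℝ) (i : ℤ) : ℝ :=
  1 / 2 * ∑ k ∈ Finset.range (n + 1),
    (n.choose k : ℝ) * ((fdq h)^[k] z i * (fdq h)^[n - k + 2] z (i - 1 + k))

lemma fdq_two (z : ℤ → ℝ) (i : ℤ) :
    (fdq h)^[2] z (i - 1) = (z (i + 1) - 2 * z i + z (i - 1)) / h ^ 2 := by
  simp only [fdq_iterate_succ, Function.iterate_zero, id, sub_add_cancel]
  rcases eq_or_ne h 0 with rfl | hh
  · simp
  · field_simp
    ring

lemma IsLatticeSol.hasDerivWithinAt_fdq {τ : ℝ} {z : ℝ → ℤ → ℝ} (hz : IsLatticeSol h τ z)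
    (n : ℕ) {t : ℝ} (ht : t ∈ Icc 0 τ) (i : ℤ) :
    HasDerivWithinAt (fun s => (fdq h)^[n] (z s) i) (latticeRate h n (z t) i) (Icc 0 τ) t := by
  have h1 := fdq_iterate_hasDerivWithinAt (h := h) n (fun i => hz t ht i) i
  convert h1 using 1
  have e : (fun i => z t i * (z t (i + 1) - 2 * z t i + z t (i - 1)) / (2 * h ^ 2))
      = fun j => 1 / 2 * (z t j * (fdq h)^[2] (z t) (j + (-1))) := by
    ext j
    rw [← sub_eq_add_neg, fdq_two]
    ring
  rw [e, fdq_iterate_const_mul, fdq_iterate_mul, latticeRate]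
  congr 1
  refine Finset.sum_congr rfl fun k _ => ?_
  rw [fdq_iterate_shift, ← Function.iterate_add_apply,
    show i + (k : ℤ) + -1 = i - 1 + k by ring]

/-- At an extremum of the `n`-th difference quotient, its rate of change is controlled by the
second differences. -/
lemma latticeRate_le_of_extremum (hh : 0 < h) {z : ℤ → ℝ} (hz : ∀ i, 0 ≤ z i) {n : ℕ}
    (hn : 3 ≤ n) {K m β σ : ℝ} (hσ : |σ| = 1) (hK : ∀ i, |(fdq h)^[2] z i| ≤ K)
    (hm : ∀ i, |(fdq h)^[n] z i| ≤ m) (hβ : ∀ k, 3 ≤ k → k < n → ∀ i, |(fdq h)^[k] z i| ≤ β)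
    {i : ℤ} (hi : σ * (fdq h)^[n] z i = m) :
    σ * latticeRate h n z i ≤ (n ^ 2 + 2 ^ n) * K * m + 2 ^ n * β ^ 2 := by
  have hK0 : 0 ≤ K := (abs_nonneg _).trans (hK 0)
  have hm0 : 0 ≤ m := (abs_nonneg _).trans (hm 0)
  have hh2 : 0 < h ^ 2 := by positivity
  obtain ⟨p, rfl⟩ : ∃ p, n = p + 2 := ⟨n - 2, by omega⟩
  set n := p + 2 with hn_def
  set y : ℤ → ℝ := fun j => σ * (fdq h)^[n] z j with hy
  have hym : ∀ j, |y j| ≤ m := fun j => by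
    rw [hy]
    simp only [abs_mul, hσ, one_mul]
    exact hm j
  -- the transport and diffusion terms
  have hmain : σ * (z i * (fdq h)^[n + 2] z (i - 1) + n * ((fdq h)^[1] z i * (fdq h)^[n + 1] z i))
      ≤ 2 * (n ^ 2 * K * m) := by
    have e1 : (fdq h)^[n + 2] z (i - 1) = ((fdq h)^[n] z (i + 1) - 2 * (fdq h)^[n] z i
        + (fdq h)^[n] z (i - 1)) / h ^ 2 := by
      rw [add_comm n 2, Function.iterate_add_apply, fdq_two]
    have e2 : (fdq h)^[n + 1] z i = ((fdq h)^[n] z (i + 1) - (fdq h)^[n] z i) / h :=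
      fdq_iterate_succ _ _ _
    have e3 : (fdq h)^[1] z i = (z (i + 1) - z i) / h := rfl
    have e : σ * (z i * (fdq h)^[n + 2] z (i - 1)
        + n * ((fdq h)^[1] z i * (fdq h)^[n + 1] z i))
        = ((z i + n * (z (i + 1) - z i)) * (y (i + 1) - y i) - z i * (y i - y (i - 1))) / h ^ 2 := by
      rw [e1, e2, e3, hy]
      field_simp
      ring
    have ht := abs_taylor_le_of_abs_fdq_le hh hK i (i + n)
    have hfd : h * fdq h z i = z (i + 1) - z i := by
      rw [fdq]; field_simp
    push_cast at ht
    rw [add_sub_cancel_left, mul_assoc, hfd] at ht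
    have hyi : y i = m := hi
    have hy1 := abs_le.1 (hym (i + 1))
    have hy2 := abs_le.1 (hym (i - 1))
    rw [e, div_le_iff₀ hh2]
    set ρ := z (i + n) - z i - n * (z (i + 1) - z i) with hρ
    have e4 : z i + n * (z (i + 1) - z i) = z (i + n) - ρ := by rw [hρ]; ring
    rw [e4]
    have t1 : z (i + n) * (y (i + 1) - y i) ≤ 0 :=
      mul_nonpos_of_nonneg_of_nonpos (hz _) (by linarith)
    have t2 : 0 ≤ z i * (y i - y (i - 1)) := mul_nonneg (hz _) (by linarith)
    have t3 : -ρ * (y (i + 1) - y i) ≤ K * (n * h) ^ 2 * (2 * m) := by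
      refine (le_abs_self _).trans ?_
      rw [abs_mul, abs_neg]
      refine mul_le_mul ht ?_ (abs_nonneg _) (by positivity)
      rw [abs_le]
      constructor <;> linarith
    nlinarith
  -- the remaining terms
  have hrest : ∀ k ∈ Finset.range (p + 1), σ * ((n.choose (k + 2) : ℝ) * ((fdq h)^[k + 2] z i
      * (fdq h)^[n - (k + 2) + 2] z (i - 1 + (k + 2 : ℕ)))) ≤ n.choose (k + 2) * (K * m + β ^ 2) := by
    intro k hk
    have hk' : k ≤ p := Nat.lt_succ_iff.1 (Finset.mem_range.1 hk)
    refine (le_abs_self _).trans ?_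
    rw [abs_mul, hσ, one_mul, abs_mul, Nat.abs_cast]
    refine mul_le_mul_of_nonneg_left ?_ (Nat.cast_nonneg _)
    rw [abs_mul]
    rcases Nat.eq_zero_or_pos k with rfl | hk0
    · have : |(fdq h)^[0 + 2] z i| * |(fdq h)^[n - (0 + 2) + 2] z (i - 1 + (0 + 2 : ℕ))|
          ≤ K * m := by
        rw [show n - (0 + 2) + 2 = n by omega]
        exact mul_le_mul (hK _) (hm _) (abs_nonneg _) hK0
      nlinarith [sq_nonneg β]
    rcases eq_or_lt_of_le hk' with rfl | hkp
    · have : |(fdq h)^[k + 2] z i| * |(fdq h)^[n - (k + 2) + 2] z (i - 1 + (k + 2 : ℕ))|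
          ≤ m * K := by
        rw [show n - (k + 2) + 2 = 2 by omega]
        exact mul_le_mul (hm _) (hK _) (abs_nonneg _) hm0
      nlinarith [sq_nonneg β]
    · have hb0 : 0 ≤ β := (abs_nonneg _).trans (hβ (k + 2) (by omega) (by omega) 0)
      have : |(fdq h)^[k + 2] z i| * |(fdq h)^[n - (k + 2) + 2] z (i - 1 + (k + 2 : ℕ))|
          ≤ β * β :=
        mul_le_mul (hβ _ (by omega) (by omega) _) (hβ _ (by omega) (by omega) _)
          (abs_nonneg _) hb0
      nlinarith [mul_nonneg hK0 hm0]
  have hchoose : ∑ k ∈ Finset.range (p + 1), (n.choose (k + 2) : ℝ) ≤ 2 ^ n := by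
    have h1 : ∑ k ∈ Finset.range (n + 1), (n.choose k : ℝ) = 2 ^ n := by
      exact_mod_cast Nat.sum_range_choose n
    rw [hn_def, Finset.sum_range_succ', Finset.sum_range_succ'] at h1
    rw [hn_def]
    have : (0 : ℝ) ≤ ((p + 2).choose (0 + 1) : ℕ) := Nat.cast_nonneg _
    have : (0 : ℝ) ≤ ((p + 2).choose 0 : ℕ) := Nat.cast_nonneg _
    linarith
  have hsum := Finset.sum_le_sum hrest
  rw [← Finset.sum_mul] at hsum
  have hKm : 0 ≤ K * m + β ^ 2 := by positivity
  have hsum' := hsum.trans (mul_le_mul_of_nonneg_right hchoose hKm)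
  rw [latticeRate, hn_def, Finset.sum_range_succ', Finset.sum_range_succ', ← hn_def]
  rw [← Finset.mul_sum] at hsum'
  have e5 : n - 0 + 2 = n + 2 := rfl
  have e6 : n - (0 + 1) + 2 = n + 1 := by omega
  have e7 : i - 1 + ((0 + 1 : ℕ) : ℤ) = i := by push_cast; ring
  have e8 : i - 1 + ((0 : ℕ) : ℤ) = i - 1 := by push_cast; ring
  rw [e5, e6, e7, e8, Nat.choose_zero_right, zero_add, Nat.choose_one_right]
  simp only [add_assoc] at hsum' ⊢
  norm_num at hsum' hmain ⊢
  nlinarith [mul_nonneg hK0 hm0, mul_nonneg (pow_nonneg (zero_le_two (α := ℝ)) n) hKm]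

end Differences

/-- Nonnegative solutions of the discretized equation supported in `[-R, R]`. -/
structure LatticeFlow (h τ R : ℝ) (z : ℝ → ℤ → ℝ) : Prop where
  pos : 0 < h
  le_one : h ≤ 1
  R_nonneg : 0 ≤ R
  sol : IsLatticeSol h τ z
  nonneg : ∀ t ∈ Icc 0 τ, ∀ i, 0 ≤ z t i
  supp : ∀ t, ∀ i : ℤ, R < |i * h| → z t i = 0

namespace LatticeFlow

variable {h τ R : ℝ} {z : ℝ → ℤ → ℝ}

lemma fdq_supp' (H : LatticeFlow h τ R z) (n : ℕ) (t : ℝ) (i : ℤ) (hi : R + n * h < |i * h|) :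
    (fdq h)^[n] (z t) i = 0 := by
  induction n generalizing i with
  | zero => exact H.supp t i (by simpa using hi)
  | succ n ih =>
    push_cast at hi
    have h1 := H.pos
    have h3 : |(i : ℝ) * h| ≤ |((i + 1 : ℤ) : ℝ) * h| + h := by
      have e : (i : ℝ) * h = ((i + 1 : ℤ) : ℝ) * h + (-h) := by push_cast; ring
      rw [e]
      refine (abs_add_le _ _).trans ?_
      rw [abs_neg, abs_of_pos h1]
    rw [fdq_iterate_succ, ih _ (by linarith), ih _ (by linarith), sub_zero, zero_div]

lemma fdq_supp (H : LatticeFlow h τ R z) (n : ℕ) (t : ℝ) (i : ℤ) (hi : R + n < |i * h|) :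
    (fdq h)^[n] (z t) i = 0 := by
  refine H.fdq_supp' n t i (lt_of_le_of_lt ?_ hi)
  have := mul_le_of_le_one_right (Nat.cast_nonneg (α := ℝ) n) H.le_one
  linarith

lemma abs_le_of_fdq (H : LatticeFlow h τ R z) {n : ℕ} {t C : ℝ}
    (hC : ∀ i, |(fdq h)^[n + 1] (z t) i| ≤ C) (i : ℤ) :
    |(fdq h)^[n] (z t) i| ≤ (2 * R + 2 * n + 1) * C := by
  have hC0 : 0 ≤ C := (abs_nonneg _).trans (hC 0)
  have hR := H.R_nonneg
  have hh := H.pos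
  by_cases hi : R + n < |i * h|
  · rw [H.fdq_supp n t i hi, abs_zero]
    positivity
  push Not at hi
  have hlip := abs_sub_le_of_abs_fdq_le hh (a := (fdq h)^[n] (z t)) (C := C)
    (fun i => by simpa only [Function.iterate_succ_apply'] using hC i) i (⌊(R + n) / h⌋ + 1)
  set j : ℤ := ⌊(R + n) / h⌋ + 1 with hj
  have hj1 : R + n < j * h := by
    have := Int.lt_floor_add_one ((R + n) / h)
    rw [div_lt_iff₀ hh] at this
    simpa [hj] using this
  have hj2 : j * h ≤ R + n + 1 := by
    have := Int.floor_le ((R + n) / h)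
    rw [le_div_iff₀ hh] at this
    have h2 := H.le_one
    rw [hj]
    push_cast
    linarith
  rw [H.fdq_supp n t j (hj1.trans_le (le_abs_self _)), zero_sub, abs_neg] at hlip
  refine hlip.trans ?_
  rw [mul_comm]
  refine mul_le_mul_of_nonneg_right ?_ hC0
  rw [abs_le] at hi ⊢
  constructor <;> linarith

/-- A finite set outside which all difference quotients of order `n` vanish. -/
lemma exists_finset (H : LatticeFlow h τ R z) (n : ℕ) :
    ∃ s : Finset ℤ, ∀ t, ∀ i ∉ s, (fdq h)^[n] (z t) i = 0 := by
  have hh := H.pos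
  refine ⟨Finset.Icc (-⌈(R + n) / h⌉) ⌈(R + n) / h⌉, fun t i hi => H.fdq_supp n t i ?_⟩
  by_contra hc
  push Not at hc
  refine hi ?_
  rw [abs_mul, abs_of_pos hh, ← le_div_iff₀ hh] at hc
  have h1 : |(i : ℝ)| ≤ ((⌈(R + n) / h⌉ : ℤ) : ℝ) := hc.trans (Int.le_ceil _)
  have h2 : |i| ≤ ⌈(R + n) / h⌉ := by exact_mod_cast h1
  rw [Finset.mem_Icc]
  exact abs_le.1 h2

lemma hasDerivWithinAt (H : LatticeFlow h τ R z) (n : ℕ) {a b t : ℝ} (ha : 0 ≤ a) (hb : b ≤ τ)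
    (ht : t ∈ Icc a b) (i : ℤ) :
    HasDerivWithinAt (fun s => (fdq h)^[n] (z s) i) (latticeRate h n (z t) i) (Icc a b) t :=
  (H.sol.hasDerivWithinAt_fdq n ⟨ha.trans ht.1, ht.2.trans hb⟩ i).mono (Icc_subset_Icc ha hb)

lemma abs_le_of_barrier (H : LatticeFlow h τ R z) {n : ℕ} (hn : 3 ≤ n) {a b : ℝ} (ha : 0 ≤ a)
    (hb : b ≤ τ) {B B' : ℝ → ℝ} (hB : ∀ t ∈ Icc a b, HasDerivWithinAt B (B' t) (Icc a b) t)
    (hB0 : ∀ t ∈ Icc a b, 0 ≤ B t) (h0 : ∀ i, |(fdq h)^[n] (z a) i| ≤ B a)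
    (hlt : ∀ t ∈ Icc a b, (∀ i, |(fdq h)^[n] (z t) i| ≤ B t) → ∃ K β : ℝ,
      (∀ i, |(fdq h)^[2] (z t) i| ≤ K) ∧
      (∀ k, 3 ≤ k → k < n → ∀ i, |(fdq h)^[k] (z t) i| ≤ β) ∧
      (n ^ 2 + 2 ^ n) * K * B t + 2 ^ n * β ^ 2 < B' t) :
    ∀ t ∈ Icc a b, ∀ i, |(fdq h)^[n] (z t) i| ≤ B t := by
  obtain ⟨s, hs⟩ := H.exists_finset n
  have key : ∀ t ∈ Icc a b, (∀ p ∈ s ×ˢ ({1, -1} : Finset ℝ),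
      p.2 * (fdq h)^[n] (z t) p.1 ≤ B t) → ∀ i, |(fdq h)^[n] (z t) i| ≤ B t := by
    intro t ht hp i
    by_cases hi : i ∈ s
    · have h1 := hp (i, 1) (by simp [hi])
      have h2 := hp (i, -1) (by simp [hi])
      simp only [one_mul, neg_mul] at h1 h2
      exact abs_le.2 ⟨by linarith, h1⟩
    · rw [hs t i hi, abs_zero]
      exact hB0 t ht
  have hσ : ∀ p ∈ s ×ˢ ({1, -1} : Finset ℝ), |p.2| = 1 := by
    intro p hp
    simp only [Finset.mem_product, Finset.mem_insert, Finset.mem_singleton] at hp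
    rcases hp.2 with h | h <;> simp [h]
  have := finset_le_of_barrier (s ×ˢ ({1, -1} : Finset ℝ)) (a := a) (b := b)
    (f := fun p t => p.2 * (fdq h)^[n] (z t) p.1)
    (f' := fun p t => p.2 * latticeRate h n (z t) p.1) (B := B) (B' := B')
    (fun p hp t ht => (H.hasDerivWithinAt n ha hb ht p.1).const_mul p.2) hB
    (fun p hp => by
      refine (le_abs_self _).trans ?_
      rw [abs_mul, hσ p hp, one_mul]
      exact h0 _)
    (fun t ht hall p hp heq => by
      obtain ⟨K, β, hK, hβ, hKβ⟩ := hlt t ht (key t ht hall)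
      exact (latticeRate_le_of_extremum H.pos (H.nonneg t ⟨ha.trans ht.1, ht.2.trans hb⟩) hn
        (hσ p hp) hK (key t ht hall) hβ heq).trans_lt hKβ)
  exact fun t ht => key t ht (this t ht)

/-- The supremum of the second difference quotients is continuous in time. -/
lemma exists_continuous_sup (H : LatticeFlow h τ R z) :
    ∃ K : ℝ → ℝ, ContinuousOn K (Icc 0 τ) ∧ (∀ t i, |(fdq h)^[2] (z t) i| ≤ K t) ∧
      ∀ t, ∃ i, K t = |(fdq h)^[2] (z t) i| := by
  obtain ⟨s, hs⟩ := H.exists_finset 2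
  have hne : (insert 0 s).Nonempty := ⟨0, by simp⟩
  refine ⟨fun t => (insert 0 s).sup' hne fun i => |(fdq h)^[2] (z t) i|, ?_, ?_, ?_⟩
  · refine ContinuousOn.finset_sup'_apply hne fun i _ => ContinuousOn.abs fun t ht => ?_
    exact (H.hasDerivWithinAt 2 le_rfl le_rfl ht i).continuousWithinAt
  · intro t i
    by_cases hi : i ∈ s
    · exact Finset.le_sup' (fun i => |(fdq h)^[2] (z t) i|) (Finset.mem_insert_of_mem hi)
    · rw [hs t i hi, abs_zero]
      exact (abs_nonneg _).trans
        (Finset.le_sup' (fun i => |(fdq h)^[2] (z t) i|) (Finset.mem_insert_self 0 s))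
  · intro t
    obtain ⟨i, _, hi⟩ := Finset.exists_mem_eq_sup' hne fun i => |(fdq h)^[2] (z t) i|
    exact ⟨i, hi⟩

lemma abs_three_le_exp (H : LatticeFlow h τ R z) {K : ℝ → ℝ} {b t : ℝ} (ht : t ∈ Icc 0 τ)
    (hKc : ContinuousOn K (Icc 0 τ)) (hK : ∀ t i, |(fdq h)^[2] (z t) i| ≤ K t)
    (h0 : ∀ i, |(fdq h)^[3] (z 0) i| ≤ b) (i : ℤ) :
    |(fdq h)^[3] (z t) i| ≤ b * Real.exp (17 * ∫ s in (0:ℝ)..t, K s) := by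
  have hb : 0 ≤ b := (abs_nonneg _).trans (h0 0)
  have hτ : 0 ≤ τ := ht.1.trans ht.2
  have key : ∀ ε > 0, |(fdq h)^[3] (z t) i|
      ≤ (b + ε * t) * Real.exp (17 * ∫ s in (0:ℝ)..t, K s) := by
    intro ε hε
    have h_int : ∀ s ∈ Icc (0:ℝ) τ, HasDerivWithinAt (fun r => ∫ s in (0:ℝ)..r, K s) (K s)
        (Icc 0 τ) s := by
      intro s hs
      have : Fact (s ∈ Icc 0 τ) := ⟨hs⟩
      have hi : IntervalIntegrable K volume 0 s := by
        refine ContinuousOn.intervalIntegrable_of_Icc hs.1 (hKc.mono (Icc_subset_Icc_right hs.2))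
      exact intervalIntegral.integral_hasDerivWithinAt_right hi
        (hKc.stronglyMeasurableAtFilter_nhdsWithin measurableSet_Icc s) (hKc s hs)
    have hB : ∀ s ∈ Icc (0:ℝ) τ, HasDerivWithinAt
        (fun r => (b + ε * r) * Real.exp (17 * ∫ s in (0:ℝ)..r, K s))
        (ε * Real.exp (17 * ∫ s in (0:ℝ)..s, K s)
          + (b + ε * s) * (Real.exp (17 * ∫ s in (0:ℝ)..s, K s) * (17 * K s))) (Icc 0 τ) s := by
      intro s hs
      have h1 : HasDerivWithinAt (fun r : ℝ => b + ε * r) ε (Icc 0 τ) s := by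
        simpa using ((hasDerivWithinAt_id s (Icc 0 τ)).const_mul ε).const_add b
      exact h1.mul (((h_int s hs).const_mul 17).exp)
    refine H.abs_le_of_barrier le_rfl le_rfl le_rfl hB ?_ ?_ ?_ t ht i
    · intro s hs
      have := hs.1
      positivity
    · intro i
      simpa using h0 i
    · intro s hs _
      refine ⟨K s, 0, hK s, fun k hk hk' => by omega, ?_⟩
      have : 0 < ε * Real.exp (17 * ∫ s in (0:ℝ)..s, K s) := by positivity
      norm_num
      nlinarith
  have hlim : Tendsto (fun ε => (b + ε * t) * Real.exp (17 * ∫ s in (0:ℝ)..t, K s)) (𝓝[>] 0)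
      (𝓝 ((b + 0 * t) * Real.exp (17 * ∫ s in (0:ℝ)..t, K s))) := by
    refine tendsto_nhdsWithin_of_tendsto_nhds (Continuous.tendsto ?_ _)
    fun_prop
  rw [zero_mul, add_zero] at hlim
  exact ge_of_tendsto hlim (eventually_mem_nhdsWithin.mono key)

lemma abs_three_extend (H : LatticeFlow h τ R z) {t M δ : ℝ} (ht : 0 ≤ t) (hM : 0 < M)
    (hδ : 0 < δ) (hδM : 17 * (2 * R + 5) * (M * Real.exp 1) * δ < 1)
    (h0 : ∀ i, |(fdq h)^[3] (z t) i| ≤ M) :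
    ∀ s ∈ Icc t (min (t + δ) τ), ∀ i, |(fdq h)^[3] (z s) i| ≤ M * Real.exp 1 := by
  intro s hs i
  have hle : ∀ s ∈ Icc t (min (t + δ) τ), M * Real.exp ((s - t) / δ) ≤ M * Real.exp 1 := by
    intro s hs
    refine mul_le_mul_of_nonneg_left (Real.exp_le_exp.2 ?_) hM.le
    rw [div_le_one hδ]
    have := hs.2.trans (min_le_left _ _)
    linarith
  refine le_trans ?_ (hle s hs)
  refine H.abs_le_of_barrier (B := fun s => M * Real.exp ((s - t) / δ))
    (B' := fun s => M * (Real.exp ((s - t) / δ) * (1 / δ))) le_rfl ht (min_le_right _ _) ?_ ?_ ?_ ?_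
    s hs i
  · intro s _
    exact ((((hasDerivWithinAt_id s _).sub_const t).div_const δ).exp).const_mul M
  · intro s _
    positivity
  · simpa using h0
  · intro s hs hall
    have h3 : ∀ i, |(fdq h)^[2 + 1] (z s) i| ≤ M * Real.exp 1 :=
      fun i => (hall i).trans (hle s hs)
    refine ⟨_, 0, H.abs_le_of_fdq h3, fun k hk hk' => by omega, ?_⟩
    have hE : 0 < M * Real.exp ((s - t) / δ) := by positivity
    have h1 : 17 * (2 * R + 5) * (M * Real.exp 1) < 1 / δ := by
      rwa [lt_div_iff₀ hδ]
    have := mul_lt_mul_of_pos_right h1 hE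
    norm_num at this ⊢
    nlinarith

/-- Bounds on higher difference quotients that do not depend on the mesh. -/
lemma exists_bounds (R τ M : ℝ) (b : ℕ → ℝ) : ∃ B : ℕ → ℝ, ∀ h z, LatticeFlow h τ R z →
    (∀ n i, |(fdq h)^[n] (z 0) i| ≤ b n) → ∀ t ∈ Icc 0 τ,
    (∀ s ∈ Icc 0 t, ∀ i, |(fdq h)^[3] (z s) i| ≤ M) →
    ∀ n, ∀ s ∈ Icc 0 t, ∀ i, |(fdq h)^[n] (z s) i| ≤ B n := by
  set P : ℕ → ℝ → Prop := fun n B => ∀ h z, LatticeFlow h τ R z →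
    (∀ n i, |(fdq h)^[n] (z 0) i| ≤ b n) → ∀ t ∈ Icc 0 τ,
    (∀ s ∈ Icc 0 t, ∀ i, |(fdq h)^[3] (z s) i| ≤ M) →
    ∀ s ∈ Icc 0 t, ∀ i, |(fdq h)^[n] (z s) i| ≤ B with hP
  have hdown : ∀ n B, P (n + 1) B → P n ((2 * R + 2 * n + 1) * B) :=
    fun n B hB h z H h0 t ht h3 s hs i => H.abs_le_of_fdq (hB h z H h0 t ht h3 s hs) i
  have h3 : P 3 M := fun h z H h0 t ht h3 => h3
  have h2 := hdown 2 _ h3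
  have h1 := hdown 1 _ h2
  have h0 := hdown 0 _ h1
  set K := (2 * R + 2 * (2 : ℕ) + 1) * M
  have hup : ∀ n, ∃ B, ∀ k, 3 ≤ k → k ≤ n → P k B := by
    intro n
    induction n with
    | zero => exact ⟨0, fun k hk hk' => by omega⟩
    | succ n ih =>
      obtain ⟨β, hβ⟩ := ih
      rcases lt_or_ge n 3 with hn | hn
      · refine ⟨M, fun k hk hk' => ?_⟩
        obtain rfl : k = 3 := by omega
        exact h3
      set c : ℝ := ((n + 1 : ℕ) : ℝ) ^ 2 + 2 ^ (n + 1) with hc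
      set d : ℝ := 2 ^ (n + 1) * β ^ 2 + 1 with hd
      have hd0 : 0 < d := by positivity
      have hnew : P (n + 1) ((b (n + 1) + d * τ) * Real.exp (c * |K| * τ)) := by
        intro h z H hinit t ht hM s hs i
        have hb0 : 0 ≤ b (n + 1) := (abs_nonneg _).trans (hinit (n + 1) 0)
        have hK := fun s hs => h2 h z H hinit t ht hM s hs
        have hβ' := fun k hk hk' => hβ k hk hk' h z H hinit t ht hM
        have hle : (b (n + 1) + d * s) * Real.exp (c * |K| * s)
            ≤ (b (n + 1) + d * τ) * Real.exp (c * |K| * τ) := by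
          have hsτ : s ≤ τ := hs.2.trans ht.2
          have hs0 := hs.1
          have : 0 ≤ c * |K| := by positivity
          have h0τ : 0 ≤ b (n + 1) + d * τ :=
            add_nonneg hb0 (mul_nonneg hd0.le (hs0.trans hsτ))
          gcongr
        refine le_trans ?_ hle
        refine H.abs_le_of_barrier (a := 0) (b := t)
          (B := fun s => (b (n + 1) + d * s) * Real.exp (c * |K| * s))
          (B' := fun s => d * Real.exp (c * |K| * s)
            + (b (n + 1) + d * s) * (Real.exp (c * |K| * s) * (c * |K|)))
          (by omega) le_rfl ht.2 ?_ ?_ ?_ ?_ s hs i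
        · intro s _
          have e1 : HasDerivWithinAt (fun r : ℝ => b (n + 1) + d * r) d (Icc 0 t) s := by
            simpa using ((hasDerivWithinAt_id s (Icc 0 t)).const_mul d).const_add (b (n + 1))
          have e2 : HasDerivWithinAt (fun r : ℝ => c * |K| * r) (c * |K|) (Icc 0 t) s := by
            simpa using (hasDerivWithinAt_id s (Icc 0 t)).const_mul (c * |K|)
          exact e1.mul e2.exp
        · intro s hs
          have := hs.1
          positivity
        · intro i
          simpa using hinit (n + 1) i
        · intro s hs _
          refine ⟨|K|, β, fun i => (hK s hs i).trans (le_abs_self _),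
            fun k hk hk' => hβ' k hk (by omega) s hs, ?_⟩
          have hcK : 0 ≤ c * |K| := by positivity
          have : 1 ≤ Real.exp (c * |K| * s) := Real.one_le_exp (mul_nonneg hcK hs.1)
          have : d ≤ d * Real.exp (c * |K| * s) := le_mul_of_one_le_right hd0.le this
          have e : c * |K| * ((b (n + 1) + d * s) * Real.exp (c * |K| * s))
            = (b (n + 1) + d * s) * (Real.exp (c * |K| * s) * (c * |K|)) := by ring
          rw [e]
          linarith
      refine ⟨max β ((b (n + 1) + d * τ) * Real.exp (c * |K| * τ)), fun k hk hk' => ?_⟩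
      rcases Nat.lt_or_ge k (n + 1) with hlt | hge
      · exact fun h z H hi t ht hM s hs i =>
          (hβ k hk (by omega) h z H hi t ht hM s hs i).trans (le_max_left _ _)
      · obtain rfl : k = n + 1 := by omega
        exact fun h z H hi t ht hM s hs i =>
          (hnew h z H hi t ht hM s hs i).trans (le_max_right _ _)
  have hall : ∀ n, ∃ B, P n B := by
    intro n
    match n with
    | 0 => exact ⟨_, h0⟩
    | 1 => exact ⟨_, h1⟩
    | 2 => exact ⟨_, h2⟩
    | n + 3 =>
      obtain ⟨B, hB⟩ := hup (n + 3)
      exact ⟨B, hB _ (by omega) le_rfl⟩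
  choose B hB using hall
  exact ⟨B, fun h z H hi t ht hM n => hB n h z H hi t ht hM⟩

end LatticeFlow

/-- A bound for `latticeRate` in terms of bounds for the difference quotients. -/
def rateBound (B : ℕ → ℝ) (n : ℕ) : ℝ :=
  1 / 2 * ∑ k ∈ Finset.range (n + 1), (n.choose k : ℝ) * (B k * B (n - k + 2))

/-- A Lipschitz constant for `latticeRate` in terms of bounds `B` and Lipschitz constants `L`
for the difference quotients. -/
def rateLip (B L : ℕ → ℝ) (n : ℕ) : ℝ :=
  1 / 2 * ∑ k ∈ Finset.range (n + 1),
    (n.choose k : ℝ) * (L k * B (n - k + 2) + B k * L (n - k + 2))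

lemma abs_latticeRate_le {h : ℝ} {z : ℤ → ℝ} {B : ℕ → ℝ}
    (hB : ∀ n i, |(fdq h)^[n] z i| ≤ B n) (n : ℕ) (i : ℤ) :
    |latticeRate h n z i| ≤ rateBound B n := by
  rw [latticeRate, rateBound, abs_mul, abs_of_pos (by norm_num : (0 : ℝ) < 1 / 2)]
  refine mul_le_mul_of_nonneg_left ((Finset.abs_sum_le_sum_abs _ _).trans ?_) (by norm_num)
  refine Finset.sum_le_sum fun k _ => ?_
  rw [abs_mul, Nat.abs_cast, abs_mul]
  exact mul_le_mul_of_nonneg_left (mul_le_mul (hB _ _) (hB _ _) (abs_nonneg _)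
    ((abs_nonneg _).trans (hB _ 0))) (Nat.cast_nonneg _)

lemma abs_latticeRate_sub_le {h d : ℝ} {z w : ℤ → ℝ} {B L : ℕ → ℝ}
    (hz : ∀ n i, |(fdq h)^[n] z i| ≤ B n) (hw : ∀ n i, |(fdq h)^[n] w i| ≤ B n)
    (hL : ∀ n i, |(fdq h)^[n] z i - (fdq h)^[n] w i| ≤ L n * d) (n : ℕ) (i : ℤ) :
    |latticeRate h n z i - latticeRate h n w i| ≤ rateLip B L n * d := by
  rw [latticeRate, latticeRate, rateLip, ← mul_sub, abs_mul,
    abs_of_pos (by norm_num : (0 : ℝ) < 1 / 2), mul_assoc, ← Finset.sum_sub_distrib,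
    Finset.sum_mul]
  refine mul_le_mul_of_nonneg_left ((Finset.abs_sum_le_sum_abs _ _).trans ?_) (by norm_num)
  refine Finset.sum_le_sum fun k _ => ?_
  rw [← mul_sub, abs_mul, Nat.abs_cast, mul_assoc]
  refine mul_le_mul_of_nonneg_left ?_ (Nat.cast_nonneg _)
  have e : ∀ a b c d : ℝ, a * b - c * d = (a - c) * b + c * (b - d) := fun a b c d => by ring
  rw [e]
  refine (abs_add_le _ _).trans ?_
  rw [abs_mul, abs_mul]
  have h1 := mul_le_mul (hL k i) (hz (n - k + 2) (i - 1 + k)) (abs_nonneg _)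
    ((abs_nonneg _).trans (hL k i))
  have h2 := mul_le_mul (hw k i) (hL (n - k + 2) (i - 1 + k)) (abs_nonneg _)
    ((abs_nonneg _).trans (hw k i))
  linarith

/-- A sequence of lattice flows with mesh tending to zero whose difference quotients are
bounded on `[0, t]` independently of the mesh. -/
structure BoundedFlows (𝒰 : Ultrafilter ℕ) (h : ℕ → ℝ) (τ R : ℝ) (z : ℕ → ℝ → ℤ → ℝ)
    (t : ℝ) (B : ℕ → ℝ) : Prop where
  flow : ∀ N, LatticeFlow (h N) τ R (z N)
  mesh : Tendsto h 𝒰 (𝓝 0)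
  mem : t ∈ Icc 0 τ
  bound : ∀ᶠ N in 𝒰, ∀ n, ∀ s ∈ Icc 0 t, ∀ i, |(fdq (h N))^[n] (z N s) i| ≤ B n

/-- The limit of the `n`-th difference quotients along an ultrafilter. -/
def flowLim (𝒰 : Ultrafilter ℕ) (h : ℕ → ℝ) (z : ℕ → ℝ → ℤ → ℝ) (n : ℕ) (s x : ℝ) : ℝ :=
  limUnder 𝒰 fun N => (fdq (h N))^[n] (z N s) ⌊x / h N⌋

/-- The time derivative of `flowLim`. -/
def flowRate (p : ℕ → ℝ → ℝ → ℝ) (n : ℕ) (s x : ℝ) : ℝ :=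
  1 / 2 * ∑ k ∈ Finset.range (n + 1), (n.choose k : ℝ) * (p k s x * p (n - k + 2) s x)

namespace BoundedFlows

variable {𝒰 : Ultrafilter ℕ} {h : ℕ → ℝ} {τ R t : ℝ} {z : ℕ → ℝ → ℤ → ℝ} {B : ℕ → ℝ}

lemma tendsto (H : BoundedFlows 𝒰 h τ R z t B) (n : ℕ) {s : ℝ} (hs : s ∈ Icc 0 t) (x : ℝ) :
    Tendsto (fun N => (fdq (h N))^[n] (z N s) ⌊x / h N⌋) 𝒰 (𝓝 (flowLim 𝒰 h z n s x)) := by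
  refine tendsto_nhds_limUnder ?_
  have hmem : ∀ᶠ N in 𝒰, (fdq (h N))^[n] (z N s) ⌊x / h N⌋ ∈ Icc (-B n) (B n) :=
    H.bound.mono fun N hN => abs_le.1 (hN n s hs _)
  obtain ⟨y, _, hy⟩ := (isCompact_Icc (a := -B n) (b := B n)).ultrafilter_le_nhds
    (𝒰.map fun N => (fdq (h N))^[n] (z N s) ⌊x / h N⌋) (le_principal_iff.2 hmem)
  exact ⟨y, hy⟩

lemma tendsto_floor (H : BoundedFlows 𝒰 h τ R z t B) (x : ℝ) :
    Tendsto (fun N => (⌊x / h N⌋ : ℝ) * h N) 𝒰 (𝓝 x) := by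
  refine tendsto_order.2 ⟨fun a ha => ?_, fun a ha => ?_⟩
  · filter_upwards [H.mesh.eventually_lt_const (sub_pos.2 ha)] with N hN
    have h1 := Int.lt_floor_add_one (x / h N)
    rw [div_lt_iff₀ (H.flow N).pos] at h1
    linarith
  · refine Eventually.of_forall fun N => ?_
    have h1 := Int.floor_le (x / h N)
    rw [le_div_iff₀ (H.flow N).pos] at h1
    linarith

lemma tendsto_shift (H : BoundedFlows 𝒰 h τ R z t B) (n : ℕ) {s : ℝ} (hs : s ∈ Icc 0 t) (x : ℝ)
    (c : ℕ → ℤ) (hc : Tendsto (fun N => c N * h N) 𝒰 (𝓝 x)) :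
    Tendsto (fun N => (fdq (h N))^[n] (z N s) (c N)) 𝒰 (𝓝 (flowLim 𝒰 h z n s x)) := by
  have h1 := H.tendsto n hs x
  refine h1.congr_dist ?_
  have h2 : Tendsto (fun N => B (n + 1) * |c N * h N - ⌊x / h N⌋ * h N|) 𝒰 (𝓝 0) := by
    have := ((hc.sub (H.tendsto_floor x)).abs).const_mul (B (n + 1))
    simpa using this
  refine squeeze_zero' (Eventually.of_forall fun _ => dist_nonneg) ?_ h2
  filter_upwards [H.bound] with N hN
  rw [dist_comm, Real.dist_eq, ← sub_mul]
  exact abs_sub_le_of_abs_fdq_le (H.flow N).pos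
    (fun i => by simpa only [Function.iterate_succ_apply'] using hN (n + 1) s hs i) _ _

lemma tendsto_add (H : BoundedFlows 𝒰 h τ R z t B) (n : ℕ) {s : ℝ} (hs : s ∈ Icc 0 t) (x : ℝ)
    (c : ℤ) : Tendsto (fun N => (fdq (h N))^[n] (z N s) (⌊x / h N⌋ + c)) 𝒰
      (𝓝 (flowLim 𝒰 h z n s x)) := by
  refine H.tendsto_shift n hs x (fun N => ⌊x / h N⌋ + c) ?_
  have := (H.tendsto_floor x).add (H.mesh.const_mul (c : ℝ))
  simp only [mul_zero, add_zero] at this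
  refine this.congr fun N => ?_
  push_cast
  ring

lemma abs_le (H : BoundedFlows 𝒰 h τ R z t B) (n : ℕ) {s : ℝ} (hs : s ∈ Icc 0 t) (x : ℝ) :
    |flowLim 𝒰 h z n s x| ≤ B n :=
  le_of_tendsto (H.tendsto n hs x).abs (H.bound.mono fun _ hN => hN n s hs _)

lemma bound_nonneg (H : BoundedFlows 𝒰 h τ R z t B) (n : ℕ) : 0 ≤ B n :=
  (abs_nonneg _).trans (H.abs_le n (s := 0) ⟨le_rfl, H.mem.1⟩ 0)

lemma space_taylor (H : BoundedFlows 𝒰 h τ R z t B) (n : ℕ) {s : ℝ} (hs : s ∈ Icc 0 t) (x y : ℝ) :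
    |flowLim 𝒰 h z n s y - flowLim 𝒰 h z n s x - (y - x) * flowLim 𝒰 h z (n + 1) s x|
      ≤ B (n + 2) * (y - x) ^ 2 := by
  have hd := (H.tendsto_floor y).sub (H.tendsto_floor x)
  refine le_of_tendsto_of_tendsto (((H.tendsto n hs y).sub (H.tendsto n hs x)).sub
    (hd.mul (H.tendsto (n + 1) hs x))).abs ((hd.pow 2).const_mul (B (n + 2))) ?_
  filter_upwards [H.bound] with N hN
  rw [← sub_mul, Function.iterate_succ_apply']
  exact abs_taylor_le_of_abs_fdq_le (H.flow N).pos
    (fun i => by simpa only [Function.iterate_succ_apply'] using hN (n + 2) s hs i) _ _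

lemma discrete_time_lip (H : BoundedFlows 𝒰 h τ R z t B) {N : ℕ}
    (hN : ∀ n, ∀ s ∈ Icc 0 t, ∀ i, |(fdq (h N))^[n] (z N s) i| ≤ B n) (n : ℕ) {s r : ℝ}
    (hs : s ∈ Icc 0 t) (hr : r ∈ Icc 0 t) (i : ℤ) :
    |(fdq (h N))^[n] (z N r) i - (fdq (h N))^[n] (z N s) i| ≤ rateBound B n * |r - s| :=
  (convex_Icc (0 : ℝ) t).norm_image_sub_le_of_norm_hasDerivWithin_le
    (fun _ hq => (H.flow N).hasDerivWithinAt n le_rfl H.mem.2 hq i)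
    (fun q hq => abs_latticeRate_le (fun n i => hN n q hq i) n i) hs hr

lemma discrete_time_taylor (H : BoundedFlows 𝒰 h τ R z t B) {N : ℕ}
    (hN : ∀ n, ∀ s ∈ Icc 0 t, ∀ i, |(fdq (h N))^[n] (z N s) i| ≤ B n) (n : ℕ) {s r : ℝ}
    (hs : s ∈ Icc 0 t) (hr : r ∈ Icc 0 t) (i : ℤ) :
    |(fdq (h N))^[n] (z N r) i - (fdq (h N))^[n] (z N s) i
        - (r - s) * latticeRate (h N) n (z N s) i|
      ≤ rateLip B (rateBound B) n * (r - s) ^ 2 := by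
  have hsub : uIcc s r ⊆ Icc 0 t := uIcc_subset_Icc hs hr
  have hlip : 0 ≤ rateLip B (rateBound B) n := by
    have := abs_latticeRate_sub_le (d := 1) (L := rateBound B) (fun n i => hN n s hs i)
      (fun n i => hN n s hs i) (fun n i => by
        rw [sub_self, abs_zero, mul_one]
        exact (abs_nonneg _).trans (abs_latticeRate_le (fun n i => hN n s hs i) n i)) n i
    rw [mul_one] at this
    exact (abs_nonneg _).trans this
  have key := (convex_uIcc s r).norm_image_sub_le_of_norm_hasDerivWithin_le
    (f := fun q => (fdq (h N))^[n] (z N q) i - q * latticeRate (h N) n (z N s) i)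
    (f' := fun q => latticeRate (h N) n (z N q) i - 1 * latticeRate (h N) n (z N s) i)
    (C := rateLip B (rateBound B) n * |r - s|)
    (fun q hq => (((H.flow N).hasDerivWithinAt n le_rfl H.mem.2 (hsub hq) i).mono hsub).sub
      ((hasDerivWithinAt_id q _).mul_const _))
    (fun q hq => by
      rw [one_mul, Real.norm_eq_abs]
      refine (abs_latticeRate_sub_le (L := rateBound B) (d := |q - s|)
        (fun n i => hN n q (hsub hq) i) (fun n i => hN n s hs i)
        (fun n i => H.discrete_time_lip hN n hs (hsub hq) i) n i).trans ?_
      exact mul_le_mul_of_nonneg_left (abs_sub_left_of_mem_uIcc hq) hlip)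
    left_mem_uIcc right_mem_uIcc
  rw [Real.norm_eq_abs, Real.norm_eq_abs, mul_assoc, ← sq, sq_abs] at key
  convert key using 2
  ring

lemma tendsto_rate (H : BoundedFlows 𝒰 h τ R z t B) (n : ℕ) {s : ℝ} (hs : s ∈ Icc 0 t) (x : ℝ) :
    Tendsto (fun N => latticeRate (h N) n (z N s) ⌊x / h N⌋) 𝒰
      (𝓝 (flowRate (flowLim 𝒰 h z) n s x)) := by
  refine Tendsto.const_mul _ (tendsto_finsetSum _ fun k _ => Tendsto.const_mul _ ?_)
  refine (H.tendsto k hs x).mul ?_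
  refine (H.tendsto_add (n - k + 2) hs x (-1 + k)).congr fun N => ?_
  rw [← add_assoc, ← sub_eq_add_neg]

lemma time_lip (H : BoundedFlows 𝒰 h τ R z t B) (n : ℕ) {s r : ℝ}
    (hs : s ∈ Icc 0 t) (hr : r ∈ Icc 0 t) (x : ℝ) :
    |flowLim 𝒰 h z n r x - flowLim 𝒰 h z n s x| ≤ rateBound B n * |r - s| :=
  le_of_tendsto ((H.tendsto n hr x).sub (H.tendsto n hs x)).abs
    (H.bound.mono fun _ hN => H.discrete_time_lip hN n hs hr _)

lemma time_taylor (H : BoundedFlows 𝒰 h τ R z t B) (n : ℕ) {s r : ℝ}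
    (hs : s ∈ Icc 0 t) (hr : r ∈ Icc 0 t) (x : ℝ) :
    |flowLim 𝒰 h z n r x - flowLim 𝒰 h z n s x
        - (r - s) * flowRate (flowLim 𝒰 h z) n s x|
      ≤ rateLip B (rateBound B) n * (r - s) ^ 2 :=
  le_of_tendsto (((H.tendsto n hr x).sub (H.tendsto n hs x)).sub
    ((H.tendsto_rate n hs x).const_mul (r - s))).abs
    (H.bound.mono fun _ hN => H.discrete_time_taylor hN n hs hr _)

lemma hasDerivAt_space (H : BoundedFlows 𝒰 h τ R z t B) (n : ℕ) {s : ℝ} (hs : s ∈ Icc 0 t)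
    (x : ℝ) : HasDerivAt (flowLim 𝒰 h z n s) (flowLim 𝒰 h z (n + 1) s x) x := by
  refine hasDerivAt_iff_isLittleO.2 ?_
  have h1 : (fun y => flowLim 𝒰 h z n s y - flowLim 𝒰 h z n s x
      - (y - x) • flowLim 𝒰 h z (n + 1) s x) =O[𝓝 x] fun y => (y - x) ^ 2 :=
    Asymptotics.IsBigO.of_bound (B (n + 2)) (Eventually.of_forall fun y => by
      rw [smul_eq_mul, Real.norm_eq_abs, Real.norm_of_nonneg (sq_nonneg _)]
      exact H.space_taylor n hs x y)
  exact h1.trans_isLittleO (by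
    simpa using Asymptotics.isLittleO_pow_sub_sub x (m := 2) one_lt_two)

lemma hasFDerivWithinAt (H : BoundedFlows 𝒰 h τ R z t B) (n : ℕ) {q : ℝ × ℝ}
    (hq : q ∈ Icc 0 t ×ˢ (univ : Set ℝ)) :
    HasFDerivWithinAt (Function.uncurry (flowLim 𝒰 h z n))
      (flowRate (flowLim 𝒰 h z) n q.1 q.2 • ContinuousLinearMap.fst ℝ ℝ ℝ
        + flowLim 𝒰 h z (n + 1) q.1 q.2 • ContinuousLinearMap.snd ℝ ℝ ℝ)
      (Icc 0 t ×ˢ (univ : Set ℝ)) q := by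
  refine hasFDerivWithinAt_iff_isLittleO.2 ?_
  set C := B (n + 2) + rateBound B (n + 1) + rateLip B (rateBound B) n with hC
  have h1 : (fun q' : ℝ × ℝ => Function.uncurry (flowLim 𝒰 h z n) q'
      - Function.uncurry (flowLim 𝒰 h z n) q
      - (flowRate (flowLim 𝒰 h z) n q.1 q.2 • ContinuousLinearMap.fst ℝ ℝ ℝ
        + flowLim 𝒰 h z (n + 1) q.1 q.2 • ContinuousLinearMap.snd ℝ ℝ ℝ) (q' - q))
      =O[𝓝[Icc 0 t ×ˢ (univ : Set ℝ)] q] fun q' => ‖q' - q‖ ^ 2 := by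
    refine Asymptotics.IsBigO.of_bound C (eventually_mem_nhdsWithin.mono fun q' hq' => ?_)
    obtain ⟨s, x⟩ := q
    obtain ⟨r, y⟩ := q'
    have hs : s ∈ Icc 0 t := hq.1
    have hr : r ∈ Icc 0 t := hq'.1
    have e1 := H.space_taylor n hr x y
    have e2 := H.time_taylor n hs hr x
    have e3 := H.time_lip (n + 1) hs hr x
    have d1 : |r - s| ≤ ‖(r - s, y - x)‖ := norm_fst_le (r - s, y - x)
    have d2 : |y - x| ≤ ‖(r - s, y - x)‖ := norm_snd_le (r - s, y - x)
    rw [norm_pow, norm_norm, Real.norm_eq_abs, Prod.mk_sub_mk]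
    set D := ‖(r - s, y - x)‖ with hD
    have hD0 : 0 ≤ D := norm_nonneg _
    simp only [Function.uncurry_apply_pair, add_apply, smul_apply,
      ContinuousLinearMap.coe_fst', ContinuousLinearMap.coe_snd', smul_eq_mul]
    have e4 : |(y - x) * (flowLim 𝒰 h z (n + 1) r x - flowLim 𝒰 h z (n + 1) s x)|
        ≤ D * (rateBound B (n + 1) * |r - s|) := by
      rw [abs_mul]
      exact mul_le_mul d2 e3 (abs_nonneg _) hD0
    have b1 := H.bound_nonneg (n + 2)
    have b2' : ∀ n, 0 ≤ rateBound B n := fun n => by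
      rw [rateBound]
      refine mul_nonneg (by norm_num) (Finset.sum_nonneg fun k _ => mul_nonneg (Nat.cast_nonneg _)
        (mul_nonneg (H.bound_nonneg _) (H.bound_nonneg _)))
    have b2 := b2' (n + 1)
    have b3 : 0 ≤ rateLip B (rateBound B) n := by
      rw [rateLip]
      refine mul_nonneg (by norm_num) (Finset.sum_nonneg fun k _ => mul_nonneg (Nat.cast_nonneg _)
        (add_nonneg (mul_nonneg (b2' _) (H.bound_nonneg _))
          (mul_nonneg (H.bound_nonneg _) (b2' _))))
    have f1 : (y - x) ^ 2 ≤ D ^ 2 := sq_le_sq' (by linarith [(_root_.abs_le.1 d2).1]) (_root_.abs_le.1 d2).2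
    have f2 : (r - s) ^ 2 ≤ D ^ 2 := sq_le_sq' (by linarith [(_root_.abs_le.1 d1).1]) (_root_.abs_le.1 d1).2
    have g1 := mul_le_mul_of_nonneg_left f1 b1
    have g2 := mul_le_mul_of_nonneg_left f2 b3
    have g3 := mul_le_mul_of_nonneg_left (mul_le_mul_of_nonneg_left d1 b2) hD0
    have e : flowLim 𝒰 h z n r y - flowLim 𝒰 h z n s x
        - (flowRate (flowLim 𝒰 h z) n s x * (r - s) + flowLim 𝒰 h z (n + 1) s x * (y - x))
      = (flowLim 𝒰 h z n r y - flowLim 𝒰 h z n r x - (y - x) * flowLim 𝒰 h z (n + 1) r x)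
        + (y - x) * (flowLim 𝒰 h z (n + 1) r x - flowLim 𝒰 h z (n + 1) s x)
        + (flowLim 𝒰 h z n r x - flowLim 𝒰 h z n s x
          - (r - s) * flowRate (flowLim 𝒰 h z) n s x) := by ring
    rw [e]
    refine (abs_add_three _ _ _).trans ?_
    rw [hC]
    nlinarith
  refine h1.trans_isLittleO ?_
  refine Asymptotics.IsLittleO.mono ?_ nhdsWithin_le_nhds
  exact Asymptotics.isLittleO_pow_sub_sub q one_lt_two

lemma continuousOn (H : BoundedFlows 𝒰 h τ R z t B) (n : ℕ) :
    ContinuousOn (Function.uncurry (flowLim 𝒰 h z n)) (Icc 0 t ×ˢ (univ : Set ℝ)) :=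
  fun _ hq => (H.hasFDerivWithinAt n hq).continuousWithinAt

lemma contDiffOn (H : BoundedFlows 𝒰 h τ R z t B) (ht : 0 < t) (n : ℕ) :
    ContDiffOn ℝ (⊤ : ℕ∞) (Function.uncurry (flowLim 𝒰 h z n)) (Icc 0 t ×ˢ (univ : Set ℝ)) := by
  have hu : UniqueDiffOn ℝ (Icc 0 t ×ˢ (univ : Set ℝ)) :=
    (uniqueDiffOn_Icc ht).prod uniqueDiffOn_univ
  suffices ∀ m : ℕ, ∀ n, ContDiffOn ℝ m (Function.uncurry (flowLim 𝒰 h z n))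
      (Icc 0 t ×ˢ (univ : Set ℝ)) from contDiffOn_infty.2 fun m => this m n
  intro m
  induction m with
  | zero => exact fun n => contDiffOn_zero.2 (H.continuousOn n)
  | succ m ih =>
    intro n
    push_cast
    refine (contDiffOn_succ_iff_hasFDerivWithinAt_of_uniqueDiffOn hu).2
      ⟨fun h => by simp at h, _, ?_, fun q hq => H.hasFDerivWithinAt n hq⟩
    have hrate : ContDiffOn ℝ m (fun q : ℝ × ℝ => flowRate (flowLim 𝒰 h z) n q.1 q.2)
        (Icc 0 t ×ˢ (univ : Set ℝ)) := ?_
    · exact (hrate.smul contDiffOn_const).add ((ih (n + 1)).smul contDiffOn_const)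
    refine ContDiffOn.mul contDiffOn_const (ContDiffOn.sum fun k _ => ?_)
    exact ContDiffOn.mul contDiffOn_const ((ih k).mul (ih (n - k + 2)))

lemma eq_zero (H : BoundedFlows 𝒰 h τ R z t B) (n : ℕ) {s : ℝ} (hs : s ∈ Icc 0 t) {x : ℝ}
    (hx : R < |x|) : flowLim 𝒰 h z n s x = 0 := by
  have h1 : Tendsto (fun N => R + n * h N) 𝒰 (𝓝 (R + n * 0)) :=
    (H.mesh.const_mul (n : ℝ)).const_add R
  rw [mul_zero, add_zero] at h1
  refine tendsto_nhds_unique (H.tendsto n hs x) (tendsto_const_nhds.congr' ?_)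
  filter_upwards [h1.eventually_lt (H.tendsto_floor x).abs hx] with N hN
  exact ((H.flow N).fdq_supp' n s _ hN).symm

lemma eq_initial (H : BoundedFlows 𝒰 h τ R z t B) {u₀ : ℝ → ℝ} (hu : Continuous u₀)
    (h0 : ∀ N (i : ℤ), z N 0 i = u₀ (i * h N)) (x : ℝ) : flowLim 𝒰 h z 0 0 x = u₀ x := by
  refine tendsto_nhds_unique (H.tendsto 0 ⟨le_rfl, H.mem.1⟩ x) ?_
  simp only [Function.iterate_zero, id, h0]
  exact (hu.tendsto x).comp (H.tendsto_floor x)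

lemma eventually_abs_le (H : BoundedFlows 𝒰 h τ R z t B) (n : ℕ) {ε : ℝ} (hε : 0 < ε) :
    ∀ᶠ N in 𝒰, ∀ s ∈ Icc 0 t, ∀ i : ℤ,
      |(fdq (h N))^[n] (z N s) i| ≤ |flowLim 𝒰 h z n s (i * h N)| + ε := by
  by_contra hcon
  rw [← Ultrafilter.eventually_not] at hcon
  push Not at hcon
  have hcon' : ∃ s : ℕ → ℝ, ∃ i : ℕ → ℤ, ∀ᶠ N in 𝒰, s N ∈ Icc 0 t ∧
      |flowLim 𝒰 h z n (s N) (i N * h N)| + ε < |(fdq (h N))^[n] (z N (s N)) (i N)| := by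
    classical
    choose! s hs i hi using fun N (hN : ∃ s ∈ Icc 0 t, ∃ i : ℤ,
      |flowLim 𝒰 h z n s (i * h N)| + ε < |(fdq (h N))^[n] (z N s) i|) => hN
    exact ⟨s, i, hcon.mono fun N hN => ⟨hs N hN, hi N hN⟩⟩
  obtain ⟨s, i, hsi⟩ := hcon'
  have hx : ∀ᶠ N in 𝒰, (i N : ℝ) * h N ∈ Icc (-(R + n)) (R + n) := by
    filter_upwards [hsi] with N hN
    refine _root_.abs_le.1 ?_
    by_contra hc
    have := hN.2
    rw [(H.flow N).fdq_supp n _ _ (not_le.1 hc), abs_zero] at this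
    linarith [abs_nonneg (flowLim 𝒰 h z n (s N) (i N * h N))]
  obtain ⟨s₀, hs₀, hs₁⟩ := (isCompact_Icc (a := (0 : ℝ)) (b := t)).ultrafilter_le_nhds
    (𝒰.map s) (le_principal_iff.2 (hsi.mono fun N hN => hN.1))
  obtain ⟨x₀, _, hx₁⟩ := (isCompact_Icc (a := -(R + n)) (b := R + n)).ultrafilter_le_nhds
    (𝒰.map fun N => (i N : ℝ) * h N) (le_principal_iff.2 hx)
  have hs₂ : Tendsto s 𝒰 (𝓝 s₀) := hs₁
  have hx₂ : Tendsto (fun N => (i N : ℝ) * h N) 𝒰 (𝓝 x₀) := hx₁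
  have hW : Tendsto (fun N => (fdq (h N))^[n] (z N (s N)) (i N)) 𝒰
      (𝓝 (flowLim 𝒰 h z n s₀ x₀)) := by
    refine (H.tendsto_shift n hs₀ x₀ i hx₂).congr_dist ?_
    have h2 : Tendsto (fun N => rateBound B n * |s N - s₀|) 𝒰 (𝓝 0) := by
      simpa using ((hs₂.sub_const s₀).abs).const_mul (rateBound B n)
    refine squeeze_zero' (Eventually.of_forall fun _ => dist_nonneg) ?_ h2
    filter_upwards [H.bound, hsi] with N hN hN'
    rw [dist_comm, Real.dist_eq]
    exact H.discrete_time_lip hN n hs₀ hN'.1 _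
  have hp : Tendsto (fun N => flowLim 𝒰 h z n (s N) (i N * h N)) 𝒰
      (𝓝 (flowLim 𝒰 h z n s₀ x₀)) := by
    have h1 : Tendsto (Function.uncurry (flowLim 𝒰 h z n)) (𝓝[Icc 0 t ×ˢ univ] (s₀, x₀))
        (𝓝 (Function.uncurry (flowLim 𝒰 h z n) (s₀, x₀))) :=
      H.continuousOn n (s₀, x₀) ⟨hs₀, mem_univ _⟩
    exact Tendsto.comp (f := fun N => (s N, (i N : ℝ) * h N)) h1 (tendsto_nhdsWithin_iff.2 ⟨hs₂.prodMk_nhds hx₂,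
      hsi.mono fun N hN => ⟨hN.1, mem_univ _⟩⟩)
  have := le_of_tendsto_of_tendsto (hp.abs.add_const ε) hW.abs (hsi.mono fun N hN => hN.2.le)
  linarith

end BoundedFlows

section Regularity

variable {T : ℝ} {u : ℝ → ℝ → ℝ}

/-- The spatial derivative is bounded on compact intervals. -/
lemma RegWeak.exists_deriv_bound (H : RegWeak T u) {t : ℝ} (ht : t ∈ Ico 0 T) {R : ℝ}
    (hR : 0 < R) : ∃ C, ∀ x ∈ Icc (-R) R, |u t x| ≤ C ∧ |deriv (u t) x| ≤ C := by
  obtain ⟨L, hL⟩ := H.2.1 t ht (R + 1) (by linarith)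
  have hsub : Icc (-R) R ⊆ Icc (-(R + 1)) (R + 1) := Icc_subset_Icc (by linarith) (by linarith)
  obtain ⟨C, hC⟩ := isCompact_Icc.exists_bound_of_continuousOn (hL.continuousOn.mono hsub)
  refine ⟨max C L, fun x hx => ⟨(hC x hx).trans (le_max_left _ _), ?_⟩⟩
  refine (norm_deriv_le_of_lipschitzOn (Icc_mem_nhds ?_ ?_) hL).trans (le_max_right _ _)
  · linarith [hx.1]
  · linarith [hx.2]

lemma RegWeak.tendstoUniformlyOn (H : RegWeak T u) {t₀ : ℝ} (ht₀ : t₀ ∈ Ico 0 T) {R : ℝ}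
    (hR : 0 < R) :
    TendstoUniformlyOn u (u t₀) (𝓝[Ico 0 T] t₀) (Icc (-R) R) ∧
    TendstoUniformlyOn (fun t => deriv (u t)) (deriv (u t₀)) (𝓝[Ico 0 T] t₀) (Icc (-R) R) := by
  have key : ∀ t ∈ Ico 0 T, ∀ x ∈ Icc (-R) R,
      |u t x - u t₀ x| + |deriv (u t) x - deriv (u t₀) x| ≤ ⨆ x : Icc (-R) R,
        (|u t x.1 - u t₀ x.1| + |deriv (u t) x.1 - deriv (u t₀) x.1|) := by
    intro t ht x hx
    obtain ⟨C, hC⟩ := H.exists_deriv_bound ht hR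
    obtain ⟨C', hC'⟩ := H.exists_deriv_bound ht₀ hR
    have hbdd : BddAbove (range fun x : Icc (-R) R =>
        (|u t x.1 - u t₀ x.1| + |deriv (u t) x.1 - deriv (u t₀) x.1|)) := by
      refine ⟨C + C' + (C + C'), ?_⟩
      rintro _ ⟨y, rfl⟩
      have h1 := hC y y.2
      have h2 := hC' y y.2
      exact add_le_add ((abs_sub _ _).trans (add_le_add h1.1 h2.1))
        ((abs_sub _ _).trans (add_le_add h1.2 h2.2))
    exact le_ciSup hbdd ⟨x, hx⟩
  have hev : ∀ ε > 0, ∀ᶠ t in 𝓝[Ico 0 T] t₀, ∀ x ∈ Icc (-R) R,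
      |u t x - u t₀ x| + |deriv (u t) x - deriv (u t₀) x| < ε := by
    intro ε hε
    filter_upwards [(H.2.2 t₀ ht₀ R hR).eventually_lt_const hε, eventually_mem_nhdsWithin]
      with t h1 h2 x hx
    exact (key t h2 x hx).trans_lt h1
  constructor
  · refine Metric.tendstoUniformlyOn_iff.2 fun ε hε => (hev ε hε).mono fun t h x hx => ?_
    rw [dist_comm, Real.dist_eq]
    linarith [h x hx, abs_nonneg (deriv (u t) x - deriv (u t₀) x)]
  · refine Metric.tendstoUniformlyOn_iff.2 fun ε hε => (hev ε hε).mono fun t h x hx => ?_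
    rw [dist_comm, Real.dist_eq]
    linarith [h x hx, abs_nonneg (u t x - u t₀ x)]

lemma IsStrongSolution.frequently_differentiable (H : IsStrongSolution T u) {t₀ : ℝ}
    (ht₀ : t₀ ∈ Ico 0 T) : ∃ᶠ t in 𝓝[Ico 0 T] t₀,
      ∀ x, DifferentiableAt ℝ (u t) x ∧ DifferentiableAt ℝ (deriv (u t)) x := by
  have hle : 𝓝[>] t₀ ≤ 𝓝[Ico 0 T] t₀ := by
    rw [← nhdsWithin_Ioo_eq_nhdsGT ht₀.2]
    exact nhdsWithin_mono _ fun s hs => ⟨ht₀.1.trans hs.1.le, hs.2⟩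
  refine Filter.Frequently.filter_mono ?_ hle
  intro hcon
  obtain ⟨c, hc, hsub⟩ := mem_nhdsGT_iff_exists_Ioo_subset.1 hcon
  have hc' : t₀ < c := hc
  set T' := (t₀ + T) / 2 with hT'
  have h1 : t₀ < T' := by rw [hT']; linarith [ht₀.2]
  have h2 : T' < T := by rw [hT']; linarith [ht₀.2]
  obtain ⟨g, _, hg⟩ := (H.2 T' (ht₀.1.trans_lt h1) h2).2
  rw [ae_restrict_iff' measurableSet_Ioc] at hg
  have hnull : volume (Ioo t₀ (min c T')) = 0 := by
    refine measure_mono_null ?_ hg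
    intro s hs hs'
    have hs1 := hs' ⟨ht₀.1.trans_lt hs.1, (hs.2.trans_le (min_le_right _ _)).le⟩
    exact hsub ⟨hs.1, hs.2.trans_le (min_le_left _ _)⟩ hs1.1
  rw [Real.volume_Ioo, ENNReal.ofReal_eq_zero] at hnull
  have : t₀ < min c T' := lt_min hc' h1
  linarith

lemma IsStrongSolution.hasDerivAt (H : IsStrongSolution T u) {t : ℝ} (ht : t ∈ Ico 0 T) (x : ℝ) :
    HasDerivAt (u t) (deriv (u t) x) x := by
  obtain ⟨s, hs, hs'⟩ := exists_seq_forall_of_frequently (H.frequently_differentiable ht)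
  have hR : 0 < |x| + 1 := by positivity
  obtain ⟨h1, h2⟩ := H.1.2.1.tendstoUniformlyOn ht hR
  have hsub : Ioo (-(|x| + 1)) (|x| + 1) ⊆ Icc (-(|x| + 1)) (|x| + 1) := Ioo_subset_Icc_self
  refine hasDerivAt_of_tendstoUniformlyOn (l := atTop) (f := fun n => u (s n))
    (f' := fun n => deriv (u (s n))) isOpen_Ioo ?_
    (Eventually.of_forall fun n y _ => (hs' n y).1.hasDerivAt) (fun y hy => ?_)
    (s := Ioo (-(|x| + 1)) (|x| + 1)) ⟨by linarith [neg_abs_le x], by linarith [le_abs_self x]⟩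
  · exact fun v hv => hs.eventually ((h2.mono hsub) v hv)
  · exact (h1.tendsto_at (hsub hy)).comp hs

lemma IsStrongSolution.continuous_deriv (H : IsStrongSolution T u) {t : ℝ} (ht : t ∈ Ico 0 T) :
    Continuous (deriv (u t)) := by
  refine continuous_iff_continuousAt.2 fun x => ?_
  have hR : 0 < |x| + 1 := by positivity
  have h2 := (H.1.2.1.tendstoUniformlyOn ht hR).2
  have hc := h2.continuousOn ((H.frequently_differentiable ht).mono fun s hs =>
    (fun y _ => (hs y).2.continuousAt.continuousWithinAt))
  exact hc.continuousAt (Icc_mem_nhds (by linarith [neg_abs_le x]) (by linarith [le_abs_self x]))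

lemma IsStrongSolution.continuousOn_deriv (H : IsStrongSolution T u) :
    ContinuousOn (Function.uncurry fun t x => deriv (u t) x) (Ico 0 T ×ˢ (univ : Set ℝ)) := by
  rintro ⟨t, x⟩ ⟨ht, -⟩
  have ht : t ∈ Ico 0 T := ht
  have hR : 0 < |x| + 1 := by positivity
  have h2 := (H.1.2.1.tendstoUniformlyOn ht hR).2
  refine Metric.tendsto_nhds.2 fun ε hε => ?_
  have e1 := Metric.tendstoUniformlyOn_iff.1 h2 (ε / 2) (half_pos hε)
  have e2 := Metric.tendsto_nhds.1 ((H.continuous_deriv ht).tendsto x) (ε / 2) (half_pos hε)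
  have e3 : ∀ᶠ y in 𝓝 x, y ∈ Icc (-(|x| + 1)) (|x| + 1) :=
    Icc_mem_nhds (by linarith [neg_abs_le x]) (by linarith [le_abs_self x])
  rw [nhdsWithin_prod_eq, nhdsWithin_univ]
  filter_upwards [e1.prod_mk (e2.and e3)] with q hq
  have := hq.1 q.2 hq.2.2
  rw [dist_comm] at this
  calc dist (deriv (u q.1) q.2) (deriv (u t) x)
      ≤ dist (deriv (u q.1) q.2) (deriv (u t) q.2) + dist (deriv (u t) q.2) (deriv (u t) x) :=
        dist_triangle _ _ _
    _ < ε / 2 + ε / 2 := add_lt_add this hq.2.1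
    _ = ε := add_halves ε

end Regularity

/-- A function satisfying the weak form of `m' = r` satisfies the integral form. -/
lemma eq_integral_of_weak {T : ℝ} {m r : ℝ → ℝ} (hm : ContinuousOn m (Ico 0 T))
    (hr : ContinuousOn r (Ico 0 T))
    (H : ∀ χ : ℝ → ℝ, ContDiff ℝ (⊤ : ℕ∞) χ → HasCompactSupport χ → tsupport χ ⊆ Iio T →
      m 0 * χ 0 + ∫ t in Ico 0 T, (m t * deriv χ t + χ t * r t) = 0) :
    ∀ t ∈ Ico 0 T, m t = m 0 + ∫ s in (0:ℝ)..t, r s := by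
  intro t₁ ht₁
  have hT : 0 < T := ht₁.1.trans_lt ht₁.2
  set A : ℝ → ℝ := fun t => ∫ s in (0:ℝ)..t, r s with hA
  have hAd : ∀ τ ∈ Ico 0 T, ∀ t ∈ Icc 0 τ, HasDerivWithinAt A (r t) (Icc 0 τ) t := by
    intro τ hτ t ht
    have hsub : Icc 0 τ ⊆ Ico 0 T := Icc_subset_Ico_right hτ.2
    have : Fact (t ∈ Icc 0 τ) := ⟨ht⟩
    exact intervalIntegral.integral_hasDerivWithinAt_right
      (((hr.mono hsub).mono (Icc_subset_Icc_right ht.2)).intervalIntegrable_of_Icc ht.1)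
      ((hr.mono hsub).stronglyMeasurableAtFilter_nhdsWithin measurableSet_Icc t)
      ((hr.mono hsub) t ht)
  have hAc : ContinuousOn A (Ico 0 T) := by
    intro t ht
    obtain ⟨τ, h1, h2⟩ := exists_between ht.2
    have := (hAd τ ⟨ht.1.trans h1.le, h2⟩ t ⟨ht.1, h1.le⟩).continuousWithinAt
    refine this.mono_of_mem_nhdsWithin ?_
    rw [← Ici_inter_Iic]
    exact inter_mem (mem_of_superset self_mem_nhdsWithin fun x hx => hx.1)
      (mem_nhdsWithin_of_mem_nhds (Iic_mem_nhds h1))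
  set M : ℝ → ℝ := fun t => m t - m 0 - A t with hM
  have hMc : ContinuousOn M (Ico 0 T) := (hm.sub continuousOn_const).sub hAc
  have key : ∀ η : ℝ → ℝ, ContDiff ℝ (⊤ : ℕ∞) η → HasCompactSupport η → tsupport η ⊆ Ioo 0 T →
      ∫ t, η t • M t = 0 := by
    intro η hη hηc hηs
    obtain ⟨b, hb, hηb⟩ : ∃ b ∈ Ioo 0 T, ∀ t, b ≤ t → η t = 0 := by
      rcases (tsupport η).eq_empty_or_nonempty with he | hne
      · refine ⟨T / 2, ⟨by linarith, by linarith⟩, fun t _ => ?_⟩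
        exact image_eq_zero_of_notMem_tsupport (by simp [he])
      · obtain ⟨c, hc, hcm⟩ := hηc.exists_isGreatest hne
        obtain ⟨b, h1, h2⟩ := exists_between (hηs hc).2
        refine ⟨b, ⟨(hηs hc).1.trans h1, h2⟩, fun t ht => ?_⟩
        exact image_eq_zero_of_notMem_tsupport fun h => absurd (hcm h) (by linarith)
    have hη0 : ∀ t ≤ 0, η t = 0 := fun t ht =>
      image_eq_zero_of_notMem_tsupport fun h => absurd (hηs h).1 (by linarith)
    set F : ℝ → ℝ := fun t => ∫ s in b..t, η s with hF
    have hFd : ∀ t, HasDerivAt F (η t) t := fun t =>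
      intervalIntegral.integral_hasDerivAt_right (hη.continuous.intervalIntegrable _ _)
        (hη.continuous.stronglyMeasurableAtFilter _ _) hη.continuous.continuousAt
    have hFs : ContDiff ℝ (⊤ : ℕ∞) F := by
      refine contDiff_infty_iff_deriv.2 ⟨fun t => (hFd t).differentiableAt, ?_⟩
      rwa [show deriv F = η from funext fun t => (hFd t).deriv]
    have hFb : ∀ t, b ≤ t → F t = 0 := by
      intro t ht
      refine (intervalIntegral.integral_congr (g := fun _ => 0) fun s hs => ?_).trans (by simp)
      rw [uIcc_of_le ht] at hs
      exact hηb s hs.1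
    set θ : ℝ → ℝ := fun t => Real.smoothTransition (t + 2) with hθ
    have hθs : ContDiff ℝ (⊤ : ℕ∞) θ :=
      Real.smoothTransition.contDiff.comp (contDiff_id.add contDiff_const)
    have hθ1 : ∀ t, -1 ≤ t → θ t = 1 := fun t ht =>
      Real.smoothTransition.one_of_one_le (by linarith)
    set χ : ℝ → ℝ := fun t => θ t * F t with hχ
    have hχs : ContDiff ℝ (⊤ : ℕ∞) χ := hθs.mul hFs
    have hsupp : tsupport χ ⊆ Icc (-2) b := by
      refine closure_minimal (fun t ht => ?_) isClosed_Icc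
      by_contra hc
      refine ht ?_
      rw [mem_Icc, not_and_or] at hc
      rcases hc with hc | hc
      · have : θ t = 0 := Real.smoothTransition.zero_of_nonpos (by linarith)
        simp [hχ, this]
      · simp [hχ, hFb t (by linarith)]
    have hχF : ∀ t, -1 ≤ t → χ t = F t := fun t ht => by simp [hχ, hθ1 t ht]
    have hχd : ∀ t, 0 ≤ t → HasDerivAt χ (η t) t := by
      intro t ht
      refine (hFd t).congr_of_eventuallyEq ?_
      filter_upwards [Ioi_mem_nhds (by linarith : -1 < t)] with s hs
      exact hχF s (le_of_lt hs)
    have hH := H χ hχs (isCompact_Icc.of_isClosed_subset (isClosed_tsupport _) hsupp)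
      (hsupp.trans fun t ht => ht.2.trans_lt hb.2)
    have hbI : b ∈ Ico 0 T := ⟨hb.1.le, hb.2⟩
    have hsub : Icc 0 b ⊆ Ico 0 T := Icc_subset_Ico_right hb.2
    have e1 : ∫ t in Ico 0 T, (m t * deriv χ t + χ t * r t)
        = ∫ t in (0:ℝ)..b, (m t * η t + F t * r t) := by
      rw [intervalIntegral.integral_of_le hb.1.le, ← integral_Icc_eq_integral_Ioc,
        setIntegral_eq_of_subset_of_forall_sdiff_eq_zero measurableSet_Ico hsub]
      · refine setIntegral_congr_fun measurableSet_Icc fun t ht => ?_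
        rw [(hχd t ht.1).deriv, hχF t (by linarith [ht.1])]
      · rintro t ⟨h1, h2⟩
        have hbt : b ≤ t := by
          by_contra hc
          exact h2 ⟨h1.1, (not_le.1 hc).le⟩
        rw [(hχd t h1.1).deriv, hχF t (by linarith [h1.1]), hFb t hbt, hηb t hbt]
        ring
    have hmη : IntervalIntegrable (fun t => m t * η t) volume 0 b :=
      ((hm.mono hsub).mul hη.continuous.continuousOn).intervalIntegrable_of_Icc hb.1.le
    have hAη : IntervalIntegrable (fun t => A t * η t) volume 0 b :=
      ((hAc.mono hsub).mul hη.continuous.continuousOn).intervalIntegrable_of_Icc hb.1.le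
    have hFr : IntervalIntegrable (fun t => F t * r t) volume 0 b :=
      ((hFs.continuous.continuousOn).mul (hr.mono hsub)).intervalIntegrable_of_Icc hb.1.le
    have hη' : IntervalIntegrable η volume 0 b := hη.continuous.intervalIntegrable _ _
    have e2 : ∫ t in (0:ℝ)..b, (η t * A t + F t * r t) = F b * A b - F 0 * A 0 := by
      refine intervalIntegral.integral_deriv_mul_eq_sub_of_hasDerivWithinAt ?_ ?_ hη' ?_
      · exact fun t _ => (hFd t).hasDerivWithinAt
      · rw [uIcc_of_le hb.1.le]
        exact fun t ht => hAd b hbI t ht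
      · exact (hr.mono hsub).intervalIntegrable_of_Icc hb.1.le
    have e3 : ∫ t in (0:ℝ)..b, η t = F b - F 0 :=
      intervalIntegral.integral_eq_sub_of_hasDerivAt (fun t _ => hFd t) hη'
    have hA0 : A 0 = 0 := by simp [hA]
    have e4 : ∫ t, η t • M t = ∫ t in (0:ℝ)..b, (m t * η t - m 0 * η t - A t * η t) := by
      rw [intervalIntegral.integral_of_le hb.1.le,
        ← setIntegral_eq_integral_of_forall_compl_eq_zero (s := Ioc 0 b)]
      · refine setIntegral_congr_fun measurableSet_Ioc fun t _ => ?_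
        simp only [hM, smul_eq_mul]
        ring
      · intro t ht
        rw [mem_Ioc, not_and_or] at ht
        rcases ht with ht | ht
        · rw [hη0 t (by linarith), zero_smul]
        · rw [hηb t (by linarith), zero_smul]
    rw [e1, hχF 0 (by norm_num), intervalIntegral.integral_add hmη hFr] at hH
    have e2' : ∫ t in (0:ℝ)..b, (A t * η t + F t * r t) = F b * A b - F 0 * A 0 := by
      rw [← e2]
      refine intervalIntegral.integral_congr fun t _ => ?_
      ring
    rw [intervalIntegral.integral_add hAη hFr] at e2'
    rw [e4, intervalIntegral.integral_sub (hmη.sub (hη'.const_mul _)) hAη,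
      intervalIntegral.integral_sub hmη (hη'.const_mul _), intervalIntegral.integral_const_mul, e3]
    rw [hFb b le_rfl, hA0] at *
    linarith
  have hMc' : ContinuousOn M (Ioo 0 T) := hMc.mono Ioo_subset_Ico_self
  have hae := isOpen_Ioo.ae_eq_zero_of_integral_contDiff_smul_eq_zero
    (hMc'.locallyIntegrableOn measurableSet_Ioo) key
  have heq : EqOn M (fun _ => 0) (Ioo 0 T) := by
    refine Measure.eqOn_open_of_ae_eq (μ := volume) ?_ isOpen_Ioo hMc' continuousOn_const
    exact (ae_restrict_iff' measurableSet_Ioo).2 hae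
  have h0 : M t₁ = 0 := by
    rcases eq_or_lt_of_le ht₁.1 with h | h
    · rw [← h]
      simp [hM, hA]
    · exact heq ⟨h, ht₁.2⟩
  simp only [hM] at h0
  linarith

lemma HasCompactSupport.exists_forall_lt_abs {f : ℝ → ℝ} (hf : HasCompactSupport f) :
    ∃ A, 0 < A ∧ ∀ x, A < |x| → f x = 0 := by
  obtain ⟨A, hA⟩ := hf.isCompact.isBounded.exists_norm_le
  refine ⟨max A 1, by positivity, fun x hx => image_eq_zero_of_notMem_tsupport fun h => ?_⟩
  exact absurd ((hA x h).trans (le_max_left A 1)) (by simpa using hx)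

lemma notMem_Icc_neg {A x : ℝ} : x ∉ Icc (-A) A ↔ A < |x| := by
  rw [mem_Icc, ← abs_le, not_le]

/-- `C¹` approximation of compactly supported `C¹` functions by smooth ones. -/
lemma exists_contDiff_approx {φ : ℝ → ℝ} (hφ : ContDiff ℝ 1 φ) {A : ℝ}
    (hA : ∀ x, A < |x| → φ x = 0) {ε : ℝ} (hε : 0 < ε) :
    ∃ ψ : ℝ → ℝ, ContDiff ℝ (⊤ : ℕ∞) ψ ∧ (∀ x, A + 1 < |x| → ψ x = 0) ∧
      (∀ x, |ψ x - φ x| ≤ ε) ∧ ∀ x, |deriv ψ x - deriv φ x| ≤ ε := by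
  have hc : HasCompactSupport φ :=
    HasCompactSupport.intro (isCompact_Icc (a := -A) (b := A)) fun x hx => hA x (notMem_Icc_neg.1 hx)
  have hd : Continuous (deriv φ) := hφ.continuous_deriv le_rfl
  obtain ⟨δ₁, h1, H1⟩ := Metric.uniformContinuous_iff.1
    (hc.uniformContinuous_of_continuous hφ.continuous) ε hε
  obtain ⟨δ₂, h2, H2⟩ := Metric.uniformContinuous_iff.1
    (hc.deriv.uniformContinuous_of_continuous hd) ε hε
  set δ := min 1 (min δ₁ δ₂) with hδ
  have hδ0 : 0 < δ := by positivity
  let b : ContDiffBump (0 : ℝ) := ⟨δ / 2, δ, by positivity, by linarith⟩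
  have hbo : b.rOut = δ := rfl
  set ψ := convolution (b.normed volume) φ (ContinuousLinearMap.lsmul ℝ ℝ) volume with hψ
  have hbl : LocallyIntegrable (b.normed volume) volume :=
    (b.contDiff_normed (n := 0)).continuous.locallyIntegrable
  have hder : ∀ x, deriv ψ x
      = convolution (b.normed volume) (deriv φ) (ContinuousLinearMap.lsmul ℝ ℝ) volume x :=
    fun x => (hc.hasDerivAt_convolution_right _ hbl hφ x).deriv
  refine ⟨ψ, ?_, ?_, ?_, ?_⟩
  · exact b.hasCompactSupport_normed.contDiff_convolution_left _ b.contDiff_normed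
      hφ.continuous.locallyIntegrable
  · intro x hx
    by_contra hne
    obtain ⟨y, hy, z, hz, rfl⟩ := Set.mem_add.1 (support_convolution_subset _ (Function.mem_support.2 hne))
    rw [b.support_normed_eq, hbo, mem_ball_zero_iff, Real.norm_eq_abs] at hy
    have hz' : |z| ≤ A := not_lt.1 fun h => hz (hA z h)
    have := abs_add_le y z
    have : δ ≤ 1 := min_le_left _ _
    linarith
  · intro x
    refine b.dist_normed_convolution_le hφ.continuous.aestronglyMeasurable fun y hy => (H1 ?_).le
    exact lt_of_lt_of_le hy ((min_le_right _ _).trans (min_le_left _ _))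
  · intro x
    rw [hder]
    refine b.dist_normed_convolution_le hd.aestronglyMeasurable fun y hy => (H2 ?_).le
    exact lt_of_lt_of_le hy ((min_le_right _ _).trans (min_le_right _ _))

/-- Integral form of `∂ₜ d = A - ∂ₓ B` on `[0,τ] × ℝ`, tested in space only. -/
def WeakEvol (τ : ℝ) (d A B : ℝ → ℝ → ℝ) : Prop :=
  ∀ φ : ℝ → ℝ, ContDiff ℝ 1 φ → HasCompactSupport φ → ∀ t ∈ Icc 0 τ,
    ∫ x, d t x * φ x = (∫ x, d 0 x * φ x) +
      ∫ s in (0:ℝ)..t, ∫ x, (A s x * φ x + B s x * deriv φ x)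

/-- Continuity in space-time, on a time interval. -/
def ContOnStrip (τ : ℝ) (f : ℝ → ℝ → ℝ) : Prop :=
  ContinuousOn (Function.uncurry f) (Icc 0 τ ×ˢ (univ : Set ℝ))

namespace ContOnStrip

variable {τ : ℝ} {f g : ℝ → ℝ → ℝ}

lemma continuous (hf : ContOnStrip τ f) {t : ℝ} (ht : t ∈ Icc 0 τ) : Continuous (f t) :=
  ContinuousOn.comp_continuous (f := fun x : ℝ => (t, x)) hf (by fun_prop) fun _ => ⟨ht, mem_univ _⟩

lemma of_space {φ : ℝ → ℝ} (hφ : Continuous φ) : ContOnStrip τ fun _ x => φ x :=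
  (hφ.comp continuous_snd).continuousOn

lemma mul (hf : ContOnStrip τ f) (hg : ContOnStrip τ g) : ContOnStrip τ fun t x => f t x * g t x :=
  ContinuousOn.mul hf hg

lemma add (hf : ContOnStrip τ f) (hg : ContOnStrip τ g) : ContOnStrip τ fun t x => f t x + g t x :=
  ContinuousOn.add hf hg

lemma sub (hf : ContOnStrip τ f) (hg : ContOnStrip τ g) : ContOnStrip τ fun t x => f t x - g t x :=
  ContinuousOn.sub hf hg

lemma const_mul (hf : ContOnStrip τ f) (c : ℝ) : ContOnStrip τ fun t x => c * f t x :=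
  ContinuousOn.mul continuousOn_const hf

lemma exists_bound (hf : ContOnStrip τ f) (A : ℝ) :
    ∃ C, 0 ≤ C ∧ ∀ t ∈ Icc 0 τ, ∀ x, |x| ≤ A → |f t x| ≤ C := by
  obtain ⟨C, hC⟩ := (isCompact_Icc.prod (isCompact_Icc (a := -A) (b := A))).exists_bound_of_continuousOn
    (hf.mono (prod_mono_right (subset_univ _)))
  exact ⟨max C 0, le_max_right _ _, fun t ht x hx =>
    (hC (t, x) ⟨ht, abs_le.1 hx⟩).trans (le_max_left _ _)⟩

lemma continuousOn_integral (hf : ContOnStrip τ f) {A : ℝ}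
    (hA : ∀ t ∈ Icc 0 τ, ∀ x, A < |x| → f t x = 0) :
    ContinuousOn (fun t => ∫ x, f t x) (Icc 0 τ) :=
  continuousOn_integral_of_compact_support (isCompact_Icc (a := -A) (b := A)) hf
    fun t x ht hx => hA t ht x (notMem_Icc_neg.1 hx)

end ContOnStrip

lemma integrable_of_forall_lt_abs {f : ℝ → ℝ} (hf : Continuous f) {A : ℝ}
    (hA : ∀ x, A < |x| → f x = 0) : Integrable f :=
  hf.integrable_of_hasCompactSupport
    (HasCompactSupport.intro (isCompact_Icc (a := -A) (b := A)) fun x hx => hA x (notMem_Icc_neg.1 hx))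

lemma abs_integral_sub_le {f g : ℝ → ℝ} (hf : Continuous f) (hg : Continuous g) {A c : ℝ}
    (hA0 : 0 ≤ A) (hfA : ∀ x, A < |x| → f x = 0) (hgA : ∀ x, A < |x| → g x = 0)
    (h : ∀ x, |x| ≤ A → |f x - g x| ≤ c) : |(∫ x, f x) - ∫ x, g x| ≤ c * (2 * A) := by
  rw [← integral_sub (integrable_of_forall_lt_abs hf hfA) (integrable_of_forall_lt_abs hg hgA),
    ← setIntegral_eq_integral_of_forall_compl_eq_zero (s := Icc (-A) A)]
  · have := norm_setIntegral_le_of_norm_le_const (μ := volume) (s := Icc (-A) A)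
      (f := fun x => f x - g x) measure_Icc_lt_top fun x hx => h x (abs_le.2 hx)
    rw [Real.volume_real_Icc_of_le (by linarith), Real.norm_eq_abs] at this
    linarith
  · intro x hx
    rw [hfA x (notMem_Icc_neg.1 hx), hgA x (notMem_Icc_neg.1 hx), sub_zero]

lemma abs_intervalIntegral_sub_le {τ t c : ℝ} (ht : t ∈ Icc 0 τ) {f g : ℝ → ℝ}
    (hf : ContinuousOn f (Icc 0 τ)) (hg : ContinuousOn g (Icc 0 τ))
    (h : ∀ s ∈ Icc 0 τ, |f s - g s| ≤ c) :
    |(∫ s in (0:ℝ)..t, f s) - ∫ s in (0:ℝ)..t, g s| ≤ c * t := by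
  have hsub : Icc 0 t ⊆ Icc 0 τ := Icc_subset_Icc_right ht.2
  rw [← intervalIntegral.integral_sub ((hf.mono hsub).intervalIntegrable_of_Icc ht.1)
    ((hg.mono hsub).intervalIntegrable_of_Icc ht.1)]
  have := intervalIntegral.norm_integral_le_of_norm_le_const (C := c) (a := 0) (b := t)
    (f := fun s => f s - g s) fun s hs => by
      rw [uIoc_of_le ht.1] at hs
      exact h s (hsub ⟨hs.1.le, hs.2⟩)
  rwa [sub_zero, abs_of_nonneg ht.1] at this

lemma deriv_eq_zero_of_lt_abs {φ : ℝ → ℝ} {A : ℝ} (hA : ∀ x, A < |x| → φ x = 0) {x : ℝ}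
    (hx : A < |x|) : deriv φ x = 0 := by
  have : φ =ᶠ[𝓝 x] fun _ => 0 := by
    filter_upwards [continuous_abs.continuousAt.eventually (Ioi_mem_nhds hx)] with y hy
    exact hA y hy
  rw [this.deriv_eq, deriv_const]

/-- It suffices to test the weak evolution with smooth functions. -/
lemma WeakEvol.of_smooth {τ : ℝ} {d A B : ℝ → ℝ → ℝ} (hd : ContOnStrip τ d)
    (hA : ContOnStrip τ A) (hB : ContOnStrip τ B)
    (H : ∀ φ : ℝ → ℝ, ContDiff ℝ (⊤ : ℕ∞) φ → HasCompactSupport φ → ∀ t ∈ Icc 0 τ,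
      ∫ x, d t x * φ x = (∫ x, d 0 x * φ x) +
        ∫ s in (0:ℝ)..t, ∫ x, (A s x * φ x + B s x * deriv φ x)) : WeakEvol τ d A B := by
  intro φ hφ hφc t ht
  obtain ⟨R, hR0, hR⟩ := hφc.exists_forall_lt_abs
  have hτ : 0 ≤ τ := ht.1.trans ht.2
  have h0 : (0:ℝ) ∈ Icc 0 τ := ⟨le_rfl, hτ⟩
  obtain ⟨Cd, hCd0, hCd⟩ := hd.exists_bound (R + 1)
  obtain ⟨CA, hCA0, hCA⟩ := hA.exists_bound (R + 1)
  obtain ⟨CB, hCB0, hCB⟩ := hB.exists_bound (R + 1)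
  have hR' : ∀ x, R + 1 < |x| → φ x = 0 := fun x hx => hR x (by linarith)
  have hφd : Continuous (deriv φ) := hφ.continuous_deriv le_rfl
  set I : (ℝ → ℝ) → ℝ → ℝ := fun ψ s => ∫ x, (A s x * ψ x + B s x * deriv ψ x) with hI
  have hstrip : ∀ ψ, ContDiff ℝ 1 ψ → ContOnStrip τ fun s x => A s x * ψ x + B s x * deriv ψ x :=
    fun ψ hψ => (hA.mul (.of_space hψ.continuous)).add
      (hB.mul (.of_space (hψ.continuous_deriv le_rfl)))
  have hIc : ∀ ψ, ContDiff ℝ 1 ψ → (∀ x, R + 1 < |x| → ψ x = 0) → ContinuousOn (I ψ) (Icc 0 τ) :=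
    fun ψ hψ hψR => (hstrip ψ hψ).continuousOn_integral fun s _ x hx => by
      rw [hψR x hx, deriv_eq_zero_of_lt_abs hψR hx]
      ring
  set D := (∫ x, d t x * φ x) - ((∫ x, d 0 x * φ x) + ∫ s in (0:ℝ)..t, I φ s) with hD
  set K := 2 * (Cd * (2 * (R + 1))) + (CA + CB) * (2 * (R + 1)) * t with hK
  have hK0 : 0 ≤ K := by
    have := ht.1
    positivity
  have key : ∀ ε > 0, |D| ≤ K * ε := by
    intro ε hε
    obtain ⟨ψ, hψ, hψR, h1, h2⟩ := exists_contDiff_approx hφ hR hε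
    have hψ1 : ContDiff ℝ 1 ψ := hψ.of_le (by exact_mod_cast le_top)
    have hψc : HasCompactSupport ψ :=
      HasCompactSupport.intro (isCompact_Icc (a := -(R + 1)) (b := R + 1))
        fun x hx => hψR x (notMem_Icc_neg.1 hx)
    have hH := H ψ hψ hψc t ht
    have e : ∀ s ∈ Icc 0 τ, |(∫ x, d s x * ψ x) - ∫ x, d s x * φ x| ≤ Cd * ε * (2 * (R + 1)) := by
      intro s hs
      have hds := hd.continuous hs
      refine abs_integral_sub_le (f := fun x => d s x * ψ x) (g := fun x => d s x * φ x)
        (hds.mul hψ.continuous) (hds.mul hφ.continuous) (by positivity)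
        (fun x hx => by rw [hψR x hx, mul_zero]) (fun x hx => by rw [hR' x hx, mul_zero]) ?_
      intro x hx
      rw [← mul_sub, abs_mul]
      exact mul_le_mul (hCd s hs x hx) (h1 x) (abs_nonneg _) hCd0
    have e' : ∀ s ∈ Icc 0 τ, |I ψ s - I φ s| ≤ (CA + CB) * ε * (2 * (R + 1)) := by
      intro s hs
      refine abs_integral_sub_le ((hstrip ψ hψ1).continuous hs) ((hstrip φ hφ).continuous hs)
        (by positivity) (fun x hx => ?_) (fun x hx => ?_) ?_
      · rw [hψR x hx, deriv_eq_zero_of_lt_abs hψR hx]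
        ring
      · rw [hR' x hx, deriv_eq_zero_of_lt_abs hR' hx]
        ring
      · intro x hx
        have a1 := mul_le_mul (hCA s hs x hx) (h1 x) (abs_nonneg _) hCA0
        have a2 := mul_le_mul (hCB s hs x hx) (h2 x) (abs_nonneg _) hCB0
        rw [← abs_mul] at a1 a2
        have := abs_add_le (A s x * (ψ x - φ x)) (B s x * (deriv ψ x - deriv φ x))
        rw [show A s x * ψ x + B s x * deriv ψ x - (A s x * φ x + B s x * deriv φ x)
          = A s x * (ψ x - φ x) + B s x * (deriv ψ x - deriv φ x) by ring]
        linarith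
    have e'' := abs_intervalIntegral_sub_le ht (hIc ψ hψ1 hψR) (hIc φ hφ hR') e'
    have et := abs_le.1 (e t ht)
    have e0 := abs_le.1 (e 0 h0)
    have ei := abs_le.1 e''
    rw [abs_le]
    constructor <;> (simp only [hD, hK]; linarith)
  have hD0 : D = 0 := by
    by_contra hne
    have hpos : 0 < |D| := abs_pos.2 hne
    have h1 := key (|D| / (2 * (K + 1))) (by positivity)
    have h2 : K * (|D| / (2 * (K + 1))) < |D| := by
      rw [← mul_div_assoc, div_lt_iff₀ (by positivity)]
      nlinarith
    linarith
  linarith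

lemma WeakEvol.sub {τ : ℝ} {d A B d' A' B' : ℝ → ℝ → ℝ}
    (hd : ContOnStrip τ d) (hA : ContOnStrip τ A) (hB : ContOnStrip τ B)
    (hd' : ContOnStrip τ d') (hA' : ContOnStrip τ A') (hB' : ContOnStrip τ B')
    (H : WeakEvol τ d A B) (H' : WeakEvol τ d' A' B') :
    WeakEvol τ (fun t x => d t x - d' t x) (fun t x => A t x - A' t x)
      (fun t x => B t x - B' t x) := by
  intro φ hφ hφc t ht
  obtain ⟨R, hR0, hR⟩ := hφc.exists_forall_lt_abs
  have hφd : Continuous (deriv φ) := hφ.continuous_deriv le_rfl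
  have h0 : (0:ℝ) ∈ Icc 0 τ := ⟨le_rfl, ht.1.trans ht.2⟩
  have i1 : ∀ {f}, ContOnStrip τ f → ∀ s ∈ Icc 0 τ, Integrable fun x => f s x * φ x :=
    fun hf s hs => integrable_of_forall_lt_abs ((hf.continuous hs).mul hφ.continuous)
      fun x hx => by rw [hR x hx, mul_zero]
  have z : ∀ (f g : ℝ → ℝ → ℝ) (s x), R < |x| → f s x * φ x + g s x * deriv φ x = 0 :=
    fun f g s x hx => by
      rw [hR x hx, deriv_eq_zero_of_lt_abs hR hx]
      ring
  have st : ∀ {f g}, ContOnStrip τ f → ContOnStrip τ g →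
      ContOnStrip τ fun s x => f s x * φ x + g s x * deriv φ x :=
    fun hf hg => (hf.mul (.of_space hφ.continuous)).add (hg.mul (.of_space hφd))
  have e : ∀ s ∈ Icc 0 τ, ∫ x, (d s x - d' s x) * φ x = (∫ x, d s x * φ x) - ∫ x, d' s x * φ x := by
    intro s hs
    rw [← integral_sub (i1 hd s hs) (i1 hd' s hs)]
    exact integral_congr_ae (.of_forall fun x => by ring)
  have e' : ∫ s in (0:ℝ)..t, ∫ x, ((A s x - A' s x) * φ x + (B s x - B' s x) * deriv φ x)
      = (∫ s in (0:ℝ)..t, ∫ x, (A s x * φ x + B s x * deriv φ x))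
        - ∫ s in (0:ℝ)..t, ∫ x, (A' s x * φ x + B' s x * deriv φ x) := by
    have hsub : Icc 0 t ⊆ Icc 0 τ := Icc_subset_Icc_right ht.2
    rw [← intervalIntegral.integral_sub]
    · refine intervalIntegral.integral_congr fun s hs => ?_
      rw [uIcc_of_le ht.1] at hs
      have hs' := hsub hs
      rw [← integral_sub (integrable_of_forall_lt_abs ((st hA hB).continuous hs') (z A B s))
        (integrable_of_forall_lt_abs ((st hA' hB').continuous hs') (z A' B' s))]
      exact integral_congr_ae (.of_forall fun x => by ring)
    · exact (((st hA hB).continuousOn_integral fun s _ => z A B s).mono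
        hsub).intervalIntegrable_of_Icc ht.1
    · exact (((st hA' hB').continuousOn_integral fun s _ => z A' B' s).mono
        hsub).intervalIntegrable_of_Icc ht.1
  rw [e t ht, e 0 h0, e', H φ hφ hφc t ht, H' φ hφ hφc t ht]
  ring

/-- The space-tested integral form of the equation. -/
lemma IsStrongSolution.weakEvol {T : ℝ} {u : ℝ → ℝ → ℝ} (H : IsStrongSolution T u) {τ : ℝ}
    (hτ : τ < T) : WeakEvol τ u (fun t x => -(1 / 2) * (deriv (u t) x * deriv (u t) x))
      (fun t x => -(1 / 2) * (u t x * deriv (u t) x)) := by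
  have hsub : Icc 0 τ ⊆ Ico 0 T := Icc_subset_Ico_right hτ
  have hus : ∀ {σ}, σ < T → ContOnStrip σ u := fun hσ =>
    H.1.2.1.1.mono (prod_mono_left (Icc_subset_Ico_right hσ))
  have hVs : ∀ {σ}, σ < T → ContOnStrip σ fun t x => deriv (u t) x := fun hσ =>
    H.continuousOn_deriv.mono (prod_mono_left (Icc_subset_Ico_right hσ))
  refine WeakEvol.of_smooth (hus hτ) (((hVs hτ).mul (hVs hτ)).const_mul _)
    (((hus hτ).mul (hVs hτ)).const_mul _) ?_
  intro φ hφ hφc t ht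
  obtain ⟨R, hR0, hR⟩ := hφc.exists_forall_lt_abs
  have hφd : Continuous (deriv φ) := hφ.continuous_deriv (by exact_mod_cast le_top)
  have hloc : ∀ {m : ℝ → ℝ}, (∀ σ < T, ContinuousOn m (Icc 0 σ)) → ContinuousOn m (Ico 0 T) := by
    intro m hm t ht
    obtain ⟨σ, h1, h2⟩ := exists_between ht.2
    refine (hm σ h2 t ⟨ht.1, h1.le⟩).mono_of_mem_nhdsWithin ?_
    rw [← Ici_inter_Iic]
    exact inter_mem (mem_of_superset self_mem_nhdsWithin fun x hx => hx.1)
      (mem_nhdsWithin_of_mem_nhds (Iic_mem_nhds h1))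
  have hst : ∀ σ < T, ContOnStrip σ fun s x => -(1 / 2) * (deriv (u s) x * deriv (u s) x) * φ x
      + -(1 / 2) * (u s x * deriv (u s) x) * deriv φ x := fun σ hσ =>
    ((((hVs hσ).mul (hVs hσ)).const_mul _).mul (.of_space hφ.continuous)).add
      ((((hus hσ).mul (hVs hσ)).const_mul _).mul (.of_space hφd))
  refine eq_integral_of_weak (m := fun t => ∫ x, u t x * φ x) (hloc fun σ hσ => ?_)
    (hloc fun σ hσ => ?_) ?_ t (hsub ht)
  · exact ((hus hσ).mul (.of_space hφ.continuous)).continuousOn_integral (A := R)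
      fun s _ x hx => by rw [hR x hx, mul_zero]
  · exact (hst σ hσ).continuousOn_integral (A := R) fun s _ x hx => by
      rw [hR x hx, deriv_eq_zero_of_lt_abs hR hx]
      ring
  · intro χ hχ hχc hχT
    have hs : tsupport (Function.uncurry fun t x => χ t * φ x) ⊆ tsupport χ ×ˢ tsupport φ := by
      refine closure_minimal ?_ ((isClosed_tsupport χ).prod (isClosed_tsupport φ))
      rintro ⟨s, x⟩ h
      have h : χ s * φ x ≠ 0 := h
      exact ⟨subset_tsupport _ (left_ne_zero_of_mul h), subset_tsupport _ (right_ne_zero_of_mul h)⟩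
    have hW := H.1.2.2 (fun t x => χ t * φ x)
      ((hχ.comp contDiff_fst).mul (hφ.comp contDiff_snd))
      ((hχc.isCompact.prod hφc.isCompact).of_isClosed_subset (isClosed_tsupport _) hs)
      (hs.trans (prod_mono hχT (subset_univ _)))
    refine Eq.trans (congrArg₂ (· + ·) ?_ ?_) hW
    · rw [← integral_mul_const]
      exact integral_congr_ae (.of_forall fun x => by ring)
    · refine setIntegral_congr_fun measurableSet_Ico fun s hs => ?_
      have hs' : s ∈ Icc 0 s := ⟨hs.1, le_rfl⟩
      have i1 : Integrable fun x => u s x * φ x :=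
        integrable_of_forall_lt_abs (((hus hs.2).continuous hs').mul hφ.continuous)
          fun x hx => by rw [hR x hx, mul_zero]
      have i2 := integrable_of_forall_lt_abs ((hst s hs.2).continuous hs') (A := R) fun x hx => by
        rw [hR x hx, deriv_eq_zero_of_lt_abs hR hx]
        ring
      rw [← integral_mul_const, ← integral_const_mul, ← integral_add (i1.mul_const _) (i2.const_mul _)]
      refine integral_congr_ae (.of_forall fun x => ?_)
      have d1 : deriv (fun s => χ s * φ x) s = deriv χ s * φ x :=
        ((hχ.differentiable (by simp) s).hasDerivAt.mul_const _).deriv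
      have d2 : deriv (fun y => χ s * φ y * u s y) x
          = χ s * deriv φ x * u s x + χ s * φ x * deriv (u s) x :=
        (((hφ.differentiable (by simp) x).hasDerivAt.const_mul _).mul (H.hasDerivAt hs x)).deriv
      simp only [d1, d2]
      ring

/-- Grönwall's lemma with an integrable rate and zero initial value. -/
lemma eq_zero_of_integral_le {τ : ℝ} {E e k : ℝ → ℝ} (hEc : ContinuousOn E (Icc 0 τ))
    (hpos : ∀ t ∈ Icc 0 τ, 0 ≤ E t) (he : ContinuousOn e (Icc 0 τ))
    (hE : ∀ t ∈ Icc 0 τ, E t = ∫ s in (0:ℝ)..t, e s) (hk : IntegrableOn k (Icc 0 τ))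
    (hle : ∀ᵐ t ∂(volume.restrict (Ioc 0 τ)), e t ≤ k t * E t) : ∀ t ∈ Icc 0 τ, E t = 0 := by
  intro t ht
  have hτ : 0 ≤ τ := ht.1.trans ht.2
  have hka : IntegrableOn (fun s => |k s|) (Icc 0 τ) := hk.abs
  have heI : ∀ a ∈ Icc 0 τ, ∀ b ∈ Icc 0 τ, a ≤ b → IntervalIntegrable e volume a b :=
    fun a ha b hb hab => (he.mono (Icc_subset_Icc ha.1 hb.2)).intervalIntegrable_of_Icc hab
  have hkI : ∀ a ∈ Icc 0 τ, ∀ b ∈ Icc 0 τ, a ≤ b →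
      IntervalIntegrable (fun s => |k s|) volume a b := fun a ha b hb hab =>
    (intervalIntegrable_iff_integrableOn_Icc_of_le hab).2
      (hka.mono_set (Icc_subset_Icc ha.1 hb.2))
  have hinc : ∀ a ∈ Icc 0 τ, ∀ b ∈ Icc 0 τ, a ≤ b → E b - E a = ∫ s in a..b, e s := by
    intro a ha b hb hab
    rw [hE b hb, hE a ha]
    exact intervalIntegral.integral_interval_sub_left (heI 0 ⟨le_rfl, hτ⟩ b hb hb.1)
      (heI 0 ⟨le_rfl, hτ⟩ a ha ha.1)
  refine IsClosed.Icc_subset_of_forall_exists_gt (s := {s | s ∈ Icc 0 τ ∧ E s = 0}) (a := 0)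
    (b := τ) ?_ ?_ ?_ ht |>.2
  · have := hEc.preimage_isClosed_of_isClosed isClosed_Icc (isClosed_singleton (x := (0:ℝ)))
    convert this using 1
    ext s
    simp only [mem_inter_iff, Set.mem_ofPred_eq, mem_preimage, mem_singleton_iff]
    tauto
  · exact ⟨⟨le_rfl, hτ⟩, by rw [hE 0 ⟨le_rfl, hτ⟩, intervalIntegral.integral_same]⟩
  · rintro x ⟨⟨hx, hx0⟩, hxI⟩ y hy
    have hxτ : x < τ := hxI.2
    have hprim : ContinuousWithinAt (fun z => ∫ s in x..z, |k s|) (Icc x τ) x := by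
      have := intervalIntegral.continuousOn_primitive_interval (f := fun s => |k s|) (μ := volume)
        (a := x) (b := τ)
        (by rw [uIcc_of_le hxτ.le]; exact hka.mono_set (Icc_subset_Icc_left hx.1))
      rw [uIcc_of_le hxτ.le] at this
      exact this x ⟨le_rfl, hxτ.le⟩
    have hsmall : ∀ᶠ z in 𝓝[>] x, ∫ s in x..z, |k s| < 1 / 2 := by
      have h1 : ∀ᶠ z in 𝓝[Icc x τ] x, ∫ s in x..z, |k s| < 1 / 2 :=
        hprim.eventually_lt_const (by simp)
      rw [nhdsWithin_Icc_eq_nhdsGE hxτ] at h1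
      exact h1.filter_mono (nhdsWithin_mono _ Ioi_subset_Ici_self)
    obtain ⟨y₁, hy₁1, hy₁2⟩ := (hsmall.and
      (Ioc_mem_nhdsGT (lt_min (mem_Ioi.1 hy) hxτ))).exists
    have hy₁τ : y₁ ≤ τ := hy₁2.2.trans (min_le_right _ _)
    have hy₁ : y₁ ∈ Icc 0 τ := ⟨hx.1.trans hy₁2.1.le, hy₁τ⟩
    refine ⟨y₁, ⟨hy₁, ?_⟩, hy₁2.1, hy₁2.2.trans (min_le_left _ _)⟩
    obtain ⟨z, hz, hmax⟩ := isCompact_Icc.exists_isMaxOn (nonempty_Icc.2 hy₁2.1.le)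
      (hEc.mono (Icc_subset_Icc hx.1 hy₁τ))
    have hz' : z ∈ Icc 0 τ := ⟨hx.1.trans hz.1, hz.2.trans hy₁τ⟩
    have hEz := hinc x hx z hz' hz.1
    have hle' : ∫ s in x..z, e s ≤ ∫ s in x..z, |k s| * E z := by
      refine intervalIntegral.integral_mono_ae_restrict hz.1 (heI x hx z hz' hz.1)
        ((hkI x hx z hz' hz.1).mul_const _) ?_
      have hsubset : Icc x z ⊆ Icc 0 τ := Icc_subset_Icc hx.1 hz'.2
      rw [Measure.restrict_congr_set Ioc_ae_eq_Icc] at hle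
      filter_upwards [ae_restrict_of_ae_restrict_of_subset hsubset hle,
        ae_restrict_mem measurableSet_Icc] with s hs hsm
      have h1 : E s ≤ E z := hmax ⟨hsm.1, hsm.2.trans hz.2⟩
      have h2 := hpos s (hsubset hsm)
      calc e s ≤ k s * E s := hs
        _ ≤ |k s| * E s := mul_le_mul_of_nonneg_right (le_abs_self _) h2
        _ ≤ |k s| * E z := mul_le_mul_of_nonneg_left h1 (abs_nonneg _)
    rw [intervalIntegral.integral_mul_const] at hle'
    have hmono : ∫ s in x..z, |k s| ≤ ∫ s in x..y₁, |k s| :=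
      intervalIntegral.integral_mono_interval le_rfl hz.1 hz.2 (.of_forall fun s => abs_nonneg _)
        (hkI x hx y₁ hy₁ hy₁2.1.le)
    have hz0 := hpos z hz'
    have : E z ≤ 0 := by nlinarith
    exact le_antisymm ((hmax (right_mem_Icc.2 hy₁2.1.le)).trans this) (hpos y₁ hy₁)

/-- The support of a strong solution does not grow. -/
lemma IsStrongSolution.eq_zero_of_lt_abs {T : ℝ} {u : ℝ → ℝ → ℝ} (H : IsStrongSolution T u)
    {τ : ℝ} (hτ : τ < T) {R : ℝ} (hR : ∀ x, R < |x| → u 0 x = 0) :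
    ∀ t ∈ Icc 0 τ, ∀ x, R < |x| → u t x = 0 := by
  intro t ht x₀ hx₀
  rcases eq_or_lt_of_le (ht.1.trans ht.2) with h0 | hτ0
  · rw [show t = 0 from le_antisymm (by linarith [ht.2]) ht.1]
    exact hR x₀ hx₀
  have hsub : Icc 0 τ ⊆ Ico 0 T := Icc_subset_Ico_right hτ
  have hus : ContOnStrip τ u := H.1.2.1.1.mono (prod_mono_left hsub)
  have hVs : ContOnStrip τ fun t x => deriv (u t) x :=
    H.continuousOn_deriv.mono (prod_mono_left hsub)
  let b : ContDiffBump x₀ := ⟨(|x₀| - R) / 2, |x₀| - R, by linarith, by linarith⟩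
  have hbs : ContDiff ℝ 1 b := b.contDiff
  have hbd : Continuous (deriv b) := hbs.continuous_deriv le_rfl
  obtain ⟨A, hA0, hA⟩ := b.hasCompactSupport.exists_forall_lt_abs
  have hb0 : ∀ x, u 0 x * b x = 0 := by
    intro x
    by_cases hx : R < |x|
    · rw [hR x hx, zero_mul]
    · rw [b.zero_of_le_dist, mul_zero]
      rw [Real.dist_eq, abs_sub_comm]
      have := abs_sub_abs_le_abs_sub x₀ x
      change |x₀| - R ≤ _
      linarith
  set r : ℝ → ℝ := fun s => ∫ x, (-(1 / 2) * (deriv (u s) x * deriv (u s) x) * b x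
      + -(1 / 2) * (u s x * deriv (u s) x) * deriv b x) with hr
  have hW : ∀ t ∈ Icc 0 τ, ∫ x, u t x * b x = ∫ s in (0:ℝ)..t, r s := by
    intro t ht
    have := H.weakEvol hτ b hbs b.hasCompactSupport t ht
    rwa [show ∫ x, u 0 x * b x = 0 by simp [hb0], zero_add] at this
  have hrs : ContOnStrip τ fun s x => -(1 / 2) * (deriv (u s) x * deriv (u s) x) * b x
      + -(1 / 2) * (u s x * deriv (u s) x) * deriv b x :=
    (((hVs.mul hVs).const_mul _).mul (.of_space hbs.continuous)).add
      (((hus.mul hVs).const_mul _).mul (.of_space hbd))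
  have hrz : ∀ s x, A < |x| → -(1 / 2) * (deriv (u s) x * deriv (u s) x) * b x
      + -(1 / 2) * (u s x * deriv (u s) x) * deriv b x = 0 := fun s x hx => by
    rw [hA x hx, deriv_eq_zero_of_lt_abs hA hx]
    ring
  have hub : ContOnStrip τ fun s x => u s x * b x := hus.mul (.of_space hbs.continuous)
  have hubz : ∀ s x, A < |x| → u s x * b x = 0 := fun s x hx => by rw [hA x hx, mul_zero]
  obtain ⟨g, hg, hgood⟩ := (H.2 τ hτ0 hτ).2
  have hm0 : ∀ t ∈ Icc 0 τ, ∫ x, u t x * b x = 0 := by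
    refine eq_zero_of_integral_le (hub.continuousOn_integral fun s _ => hubz s)
      (fun s hs => integral_nonneg fun x => mul_nonneg (H.1.1 s (hsub hs) x) b.nonneg)
      (hrs.continuousOn_integral fun s _ => hrz s) hW (hg.const_mul (1 / 2)) ?_
    filter_upwards [hgood, ae_restrict_mem measurableSet_Ioc] with s hs hsm
    have hs' : s ∈ Icc 0 τ := ⟨hsm.1.le, hsm.2⟩
    have i1 : Integrable fun x => u s x * b x :=
      integrable_of_forall_lt_abs (hub.continuous hs') (hubz s)
    have i2 := integrable_of_forall_lt_abs (hrs.continuous hs') (hrz s)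
    have i3 : Integrable fun x => deriv (deriv (u s)) x * (u s x * b x) := by
      refine i1.bdd_mul (measurable_deriv _).aestronglyMeasurable
        (.of_forall fun x => (hs.2 x : ‖_‖ ≤ g s))
    have hd : ∀ x, HasDerivAt (fun x => u s x * deriv (u s) x * b x)
        (deriv (deriv (u s)) x * (u s x * b x)
          - 2 * (-(1 / 2) * (deriv (u s) x * deriv (u s) x) * b x
            + -(1 / 2) * (u s x * deriv (u s) x) * deriv b x)) x := by
      intro x
      refine (((H.hasDerivAt (hsub hs') x).mul (hs.1 x).2.hasDerivAt).mul
        (hbs.differentiable (by simp) x).hasDerivAt).congr_deriv ?_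
      simp only [Pi.mul_apply]
      ring
    have i4 : Integrable fun x => u s x * deriv (u s) x * b x :=
      integrable_of_forall_lt_abs (((hus.mul hVs).mul (.of_space hbs.continuous)).continuous hs')
        (A := A) fun x hx => by rw [hA x hx, mul_zero]
    have hz := integral_eq_zero_of_hasDerivAt_of_integrable hd (i3.sub (i2.const_mul 2)) i4
    rw [integral_sub i3 (i2.const_mul 2), integral_const_mul] at hz
    have hmono : ∫ x, deriv (deriv (u s)) x * (u s x * b x) ≤ ∫ x, g s * (u s x * b x) := by
      refine integral_mono i3 (i1.const_mul _) fun x => ?_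
      exact mul_le_mul_of_nonneg_right ((le_abs_self _).trans (hs.2 x))
        (mul_nonneg (H.1.1 s (hsub hs') x) b.nonneg)
    rw [integral_const_mul] at hmono
    linarith
  by_contra hne
  have hpos : 0 < ∫ x, u t x * b x := by
    refine (hub.continuous ht).integral_pos_of_hasCompactSupport_nonneg_nonzero
      b.hasCompactSupport.mul_left (fun x => mul_nonneg (H.1.1 t (hsub ht) x) b.nonneg)
      (x := x₀) ?_
    rw [b.one_of_mem_closedBall (Metric.mem_closedBall_self b.rIn_pos.le), mul_one]
    exact hne
  exact hpos.ne' (hm0 t ht)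

/-- Energy identity for a weak evolution. -/
lemma WeakEvol.energy {τ R : ℝ} {d dx A B : ℝ → ℝ → ℝ} (H : WeakEvol τ d A B)
    (hd : ContOnStrip τ d) (hdx : ContOnStrip τ dx) (hA : ContOnStrip τ A) (hB : ContOnStrip τ B)
    (hder : ∀ t ∈ Icc 0 τ, ∀ x, HasDerivAt (d t) (dx t x) x)
    (hz : ∀ t ∈ Icc 0 τ, ∀ x, R < |x| → d t x = 0) {t : ℝ} (ht : t ∈ Icc 0 τ) :
    ∫ x, d t x * d t x = (∫ x, d 0 x * d 0 x) +
      ∫ s in (0:ℝ)..t, 2 * ∫ x, (A s x * d s x + B s x * dx s x) := by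
  have hdz : ∀ t ∈ Icc 0 τ, ∀ x, R < |x| → dx t x = 0 := fun t ht x hx => by
    rw [← (hder t ht x).deriv]
    exact deriv_eq_zero_of_lt_abs (hz t ht) hx
  set Φ : ℝ × ℝ → ℝ := fun q => ∫ x, (A q.1 x * d q.2 x + B q.1 x * dx q.2 x) with hΦ
  have fst : ∀ {f : ℝ → ℝ → ℝ}, ContOnStrip τ f →
      ContinuousOn (Function.uncurry fun (q : ℝ × ℝ) x => f q.1 x)
        ((Icc 0 τ ×ˢ Icc 0 τ) ×ˢ (univ : Set ℝ)) := fun hf =>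
    ContinuousOn.comp (f := fun p : (ℝ × ℝ) × ℝ => (p.1.1, p.2)) hf (by fun_prop)
      fun p hp => ⟨hp.1.1, hp.2⟩
  have snd : ∀ {f : ℝ → ℝ → ℝ}, ContOnStrip τ f →
      ContinuousOn (Function.uncurry fun (q : ℝ × ℝ) x => f q.2 x)
        ((Icc 0 τ ×ˢ Icc 0 τ) ×ˢ (univ : Set ℝ)) := fun hf =>
    ContinuousOn.comp (f := fun p : (ℝ × ℝ) × ℝ => (p.1.2, p.2)) hf (by fun_prop)
      fun p hp => ⟨hp.1.2, hp.2⟩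
  have hΦc : ContinuousOn Φ (Icc 0 τ ×ˢ Icc 0 τ) := by
    refine continuousOn_integral_of_compact_support (isCompact_Icc (a := -R) (b := R))
      (((fst hA).mul (snd hd)).add ((fst hB).mul (snd hdx))) fun q x hq hx => ?_
    rw [hz q.2 hq.2 x (notMem_Icc_neg.1 hx), hdz q.2 hq.2 x (notMem_Icc_neg.1 hx)]
    ring
  set E : ℝ → ℝ := fun t => ∫ x, d t x * d t x with hE
  have hEc : ContinuousOn E (Icc 0 τ) := (hd.mul hd).continuousOn_integral (A := R)
    fun s hs x hx => by rw [hz s hs x hx, mul_zero]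
  have hdc : ∀ s ∈ Icc 0 τ, HasCompactSupport (d s) := fun s hs =>
    HasCompactSupport.intro (isCompact_Icc (a := -R) (b := R)) fun x hx =>
      hz s hs x (notMem_Icc_neg.1 hx)
  have hd1 : ∀ s ∈ Icc 0 τ, ContDiff ℝ 1 (d s) := fun s hs =>
    contDiff_one_iff_deriv.2 ⟨fun x => (hder s hs x).differentiableAt, by
      rw [funext fun x => (hder s hs x).deriv]
      exact hdx.continuous hs⟩
  have h_int : ∀ r ∈ Icc 0 τ, ∀ s ∈ Icc 0 τ, Integrable fun x => A r x * d s x + B r x * dx s x :=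
    fun r hr s hs => integrable_of_forall_lt_abs
      (((hA.continuous hr).mul (hd.continuous hs)).add ((hB.continuous hr).mul (hdx.continuous hs)))
      (A := R) fun x hx => by
        rw [hz s hs x hx, hdz s hs x hx]
        ring
  have h_int_d : ∀ r ∈ Icc 0 τ, ∀ s ∈ Icc 0 τ, Integrable fun x => d r x * d s x :=
    fun r hr s hs => integrable_of_forall_lt_abs ((hd.continuous hr).mul (hd.continuous hs))
      (A := R) fun x hx => by rw [hz s hs x hx, mul_zero]
  have hW : ∀ s ∈ Icc 0 τ, ∀ r ∈ Icc 0 τ, ∫ x, d r x * d s x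
      = (∫ x, d 0 x * d s x) + ∫ q in (0:ℝ)..r, Φ (q, s) := by
    intro s hs r hr
    rw [H (d s) (hd1 s hs) (hdc s hs) r hr]
    refine congrArg _ (intervalIntegral.integral_congr fun q _ => ?_)
    refine integral_congr_ae (.of_forall fun x => ?_)
    simp only [(hder s hs x).deriv]
  have hΦI : ∀ s ∈ Icc 0 τ, ∀ a ∈ Icc 0 τ, ∀ c ∈ Icc 0 τ,
      IntervalIntegrable (fun q => Φ (q, s)) volume a c := by
    intro s hs a ha c hc
    refine (ContinuousOn.comp (f := fun q : ℝ => (q, s)) hΦc (by fun_prop) fun q hq => ?_)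
      |>.intervalIntegrable
    exact ⟨(uIcc_subset_Icc ha hc) hq, hs⟩
  have h0 : ∀ {s : ℝ}, s ∈ Icc 0 τ → (0:ℝ) ∈ Icc 0 τ := fun hs => ⟨le_rfl, hs.1.trans hs.2⟩
  have hinc : ∀ s ∈ Icc 0 τ, ∀ r ∈ Icc 0 τ,
      E r - E s = ∫ q in s..r, (Φ (q, r) + Φ (q, s)) := by
    intro s hs r hr
    have c : ∫ x, d r x * d s x = ∫ x, d s x * d r x :=
      integral_congr_ae (.of_forall fun x => mul_comm _ _)
    have e1 := hW r hr r hr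
    have e2 := hW r hr s hs
    have e3 := hW s hs r hr
    have e4 := hW s hs s hs
    rw [intervalIntegral.integral_add (hΦI r hr s hs r hr) (hΦI s hs s hs r hr),
      ← intervalIntegral.integral_interval_sub_left (hΦI r hr 0 (h0 hr) r hr)
        (hΦI r hr 0 (h0 hr) s hs),
      ← intervalIntegral.integral_interval_sub_left (hΦI s hs 0 (h0 hr) r hr)
        (hΦI s hs 0 (h0 hr) s hs)]
    simp only [hE]
    linarith
  have hderE : ∀ s ∈ Icc 0 τ, HasDerivWithinAt E (2 * Φ (s, s)) (Icc 0 τ) s := by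
    intro s hs
    rw [hasDerivWithinAt_iff_isLittleO, Asymptotics.isLittleO_iff]
    intro ε hε
    have hev : ∀ᶠ q in 𝓝[Icc 0 τ ×ˢ Icc 0 τ] (s, s), |Φ q - Φ (s, s)| < ε / 2 := by
      have := Metric.tendsto_nhds.1 (hΦc (s, s) ⟨hs, hs⟩) (ε / 2) (half_pos hε)
      exact this.mono fun q hq => by rwa [Real.dist_eq] at hq
    obtain ⟨δ, hδ, hball⟩ := Metric.mem_nhdsWithin_iff.1 hev
    filter_upwards [self_mem_nhdsWithin,
      mem_nhdsWithin_of_mem_nhds (Metric.ball_mem_nhds s hδ)] with r hr hrs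
    have hc : ∫ _ in s..r, 2 * Φ (s, s) = (r - s) • (2 * Φ (s, s)) := by
      rw [intervalIntegral.integral_const]
    have hi1 : IntervalIntegrable (fun q => Φ (q, r) + Φ (q, s)) volume s r :=
      (hΦI r hr s hs r hr).add (hΦI s hs s hs r hr)
    rw [hinc s hs r hr, ← hc, ← intervalIntegral.integral_sub hi1 (by simp)]
    have := intervalIntegral.norm_integral_le_of_norm_le_const (a := s) (b := r) (C := ε)
      (f := fun q => Φ (q, r) + Φ (q, s) - 2 * Φ (s, s)) fun q hq => by
        have hq' : q ∈ uIcc s r := uIoc_subset_uIcc hq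
        have hqτ : q ∈ Icc 0 τ := uIcc_subset_Icc hs hr hq'
        have hqs : dist q s < δ := by
          have h1 : |q - s| ≤ |r - s| := abs_sub_left_of_mem_uIcc hq'
          rw [Metric.mem_ball, Real.dist_eq] at hrs
          rw [Real.dist_eq]
          linarith
        have a1 : |Φ (q, r) - Φ (s, s)| < ε / 2 :=
          hball ⟨by rw [Metric.mem_ball, Prod.dist_eq]; exact max_lt hqs hrs, hqτ, hr⟩
        have a2 : |Φ (q, s) - Φ (s, s)| < ε / 2 :=
          hball ⟨by rw [Metric.mem_ball, Prod.dist_eq]; exact max_lt hqs (by simpa using hδ),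
            hqτ, hs⟩
        rw [Real.norm_eq_abs, abs_le]
        rw [abs_lt] at a1 a2
        constructor <;> linarith
    rwa [Real.norm_eq_abs (r - s)]
  have hΦd : ContinuousOn (fun s => 2 * Φ (s, s)) (Icc 0 t) :=
    continuousOn_const.mul (ContinuousOn.comp (f := fun q : ℝ => (q, q)) hΦc (by fun_prop)
      fun q hq => ⟨⟨hq.1, hq.2.trans ht.2⟩, ⟨hq.1, hq.2.trans ht.2⟩⟩)
  have := intervalIntegral.integral_eq_sub_of_hasDerivAt_of_le ht.1
    (hEc.mono (Icc_subset_Icc_right ht.2)) (fun s hs => (hderE s ⟨hs.1.le, hs.2.le.trans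
      ht.2⟩).hasDerivAt (Icc_mem_nhds hs.1 (hs.2.trans_le ht.2)))
    (hΦd.intervalIntegrable_of_Icc ht.1)
  simp only [hE] at this
  rw [this]
  ring

/-- A uniform first-order Taylor expansion in time gives the weak evolution. -/
lemma weakEvol_of_taylor {τ L : ℝ} {p q : ℝ → ℝ → ℝ} (hp : ContOnStrip τ p)
    (hq : ContOnStrip τ q)
    (hL : ∀ s ∈ Icc 0 τ, ∀ r ∈ Icc 0 τ, ∀ x, |p r x - p s x - (r - s) * q s x| ≤ L * (r - s) ^ 2) :
    WeakEvol τ p q fun _ _ => 0 := by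
  intro φ hφ hφc t ht
  obtain ⟨A, hA0, hA⟩ := hφc.exists_forall_lt_abs
  have hφi : Integrable φ := hφ.continuous.integrable_of_hasCompactSupport hφc
  have int : ∀ {f}, ContOnStrip τ f → ∀ s ∈ Icc 0 τ, Integrable fun x => f s x * φ x :=
    fun hf s hs => integrable_of_forall_lt_abs ((hf.continuous hs).mul hφ.continuous) (A := A)
      fun x hx => by rw [hA x hx, mul_zero]
  have hmc : ContinuousOn (fun t => ∫ x, p t x * φ x) (Icc 0 τ) :=
    (hp.mul (.of_space hφ.continuous)).continuousOn_integral (A := A)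
      fun s _ x hx => by rw [hA x hx, mul_zero]
  have hrc : ContinuousOn (fun t => ∫ x, q t x * φ x) (Icc 0 τ) :=
    (hq.mul (.of_space hφ.continuous)).continuousOn_integral (A := A)
      fun s _ x hx => by rw [hA x hx, mul_zero]
  have hder : ∀ s ∈ Icc 0 τ, HasDerivWithinAt (fun t => ∫ x, p t x * φ x) (∫ x, q s x * φ x)
      (Icc 0 τ) s := by
    intro s hs
    rw [hasDerivWithinAt_iff_isLittleO]
    have hO : (fun r => (∫ x, p r x * φ x) - (∫ x, p s x * φ x) - (r - s) • ∫ x, q s x * φ x)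
        =O[𝓝[Icc 0 τ] s] fun r => (r - s) ^ 2 := by
      refine Asymptotics.IsBigO.of_bound (L * ∫ x, |φ x|) ?_
      filter_upwards [self_mem_nhdsWithin] with r hr
      have i1 : Integrable fun x => p r x * φ x - p s x * φ x := (int hp r hr).sub (int hp s hs)
      rw [smul_eq_mul, ← integral_const_mul, ← integral_sub (int hp r hr) (int hp s hs),
        ← integral_sub i1 ((int hq s hs).const_mul _)]
      have h1 : ‖∫ x, (p r x * φ x - p s x * φ x - (r - s) * (q s x * φ x))‖
          ≤ ∫ x, L * (r - s) ^ 2 * |φ x| := by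
        refine norm_integral_le_of_norm_le (hφi.abs.const_mul _) (.of_forall fun x => ?_)
        rw [show p r x * φ x - p s x * φ x - (r - s) * (q s x * φ x)
          = (p r x - p s x - (r - s) * q s x) * φ x by ring, norm_mul]
        exact mul_le_mul_of_nonneg_right (hL s hs r hr x) (abs_nonneg _)
      rw [integral_const_mul] at h1
      rw [Real.norm_of_nonneg (sq_nonneg (r - s))]
      refine h1.trans (le_of_eq (by ring))
    have ho := (Asymptotics.isLittleO_pow_sub_sub s one_lt_two).mono
      (nhdsWithin_le_nhds (s := Icc 0 τ))
    simp only [Real.norm_eq_abs, sq_abs] at ho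
    exact hO.trans_isLittleO ho
  have hsub : Icc 0 t ⊆ Icc 0 τ := Icc_subset_Icc_right ht.2
  have := intervalIntegral.integral_eq_sub_of_hasDerivAt_of_le ht.1 (hmc.mono hsub)
    (fun s hs => (hder s (hsub ⟨hs.1.le, hs.2.le⟩)).hasDerivAt
      (Icc_mem_nhds hs.1 (hs.2.trans_le ht.2)))
    ((hrc.mono hsub).intervalIntegrable_of_Icc ht.1)
  simp only [zero_mul, add_zero]
  rw [this]
  ring

/-- Weak-strong uniqueness: a strong solution agrees with a classical solution with bounded second
derivative and the same initial data. -/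
lemma IsStrongSolution.eq_of_classical {T : ℝ} {u : ℝ → ℝ → ℝ} (H : IsStrongSolution T u)
    {τ R C L : ℝ} (hτ : τ < T) {p p₁ p₂ : ℝ → ℝ → ℝ} (hR : ∀ x, R < |x| → u 0 x = 0)
    (hp : ContOnStrip τ p) (hp₁ : ContOnStrip τ p₁) (hp₂ : ContOnStrip τ p₂)
    (hd₁ : ∀ t ∈ Icc 0 τ, ∀ x, HasDerivAt (p t) (p₁ t x) x)
    (hd₂ : ∀ t ∈ Icc 0 τ, ∀ x, HasDerivAt (p₁ t) (p₂ t x) x)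
    (hpz : ∀ t ∈ Icc 0 τ, ∀ x, R < |x| → p t x = 0)
    (hC : ∀ t ∈ Icc 0 τ, ∀ x, |p₂ t x| ≤ C)
    (hL : ∀ s ∈ Icc 0 τ, ∀ r ∈ Icc 0 τ, ∀ x,
      |p r x - p s x - (r - s) * (1 / 2 * (p s x * p₂ s x))| ≤ L * (r - s) ^ 2)
    (h0 : ∀ x, p 0 x = u 0 x) : ∀ t ∈ Icc 0 τ, ∀ x, u t x = p t x := by
  intro t ht x₀
  rcases eq_or_lt_of_le (ht.1.trans ht.2) with hτ0 | hτ0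
  · rw [show t = 0 from le_antisymm (by linarith [ht.2]) ht.1, h0]
  have hsub : Icc 0 τ ⊆ Ico 0 T := Icc_subset_Ico_right hτ
  have hus : ContOnStrip τ u := H.1.2.1.1.mono (prod_mono_left hsub)
  have hVs : ContOnStrip τ fun t x => deriv (u t) x :=
    H.continuousOn_deriv.mono (prod_mono_left hsub)
  have huz := H.eq_zero_of_lt_abs hτ hR
  have hz0 : ContOnStrip τ fun _ _ => 0 := .of_space continuous_const
  have hWp : WeakEvol τ p (fun s x => 1 / 2 * (p s x * p₂ s x)) fun _ _ => 0 :=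
    weakEvol_of_taylor hp ((hp.mul hp₂).const_mul _) hL
  have hA₁ := (hVs.mul hVs).const_mul (-(1 / 2))
  have hB₁ := (hus.mul hVs).const_mul (-(1 / 2))
  have hA₂ := (hp.mul hp₂).const_mul (1 / 2)
  have hW := (H.weakEvol hτ).sub hus hA₁ hB₁ hp hA₂ hz0 hWp
  have hd := hus.sub hp
  have hdx := hVs.sub hp₁
  have hdz : ∀ t ∈ Icc 0 τ, ∀ x, R < |x| → u t x - p t x = 0 := fun t ht x hx => by
    rw [huz t ht x hx, hpz t ht x hx, sub_zero]
  have hddx : ∀ t ∈ Icc 0 τ, ∀ x, HasDerivAt (fun x => u t x - p t x)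
      (deriv (u t) x - p₁ t x) x := fun t ht x => (H.hasDerivAt (hsub ht) x).sub (hd₁ t ht x)
  have hdxz : ∀ t ∈ Icc 0 τ, ∀ x, R < |x| → deriv (u t) x - p₁ t x = 0 := fun t ht x hx => by
    rw [← (hddx t ht x).deriv]
    exact deriv_eq_zero_of_lt_abs (hdz t ht) hx
  have hen := fun t ht => hW.energy (t := t) hd hdx (hA₁.sub hA₂) (hB₁.sub hz0) hddx hdz ht
  set J : ℝ → ℝ → ℝ := fun s x => (-(1 / 2) * (deriv (u s) x * deriv (u s) x)
    - 1 / 2 * (p s x * p₂ s x)) * (u s x - p s x)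
    + (-(1 / 2) * (u s x * deriv (u s) x) - 0) * (deriv (u s) x - p₁ s x) with hJ
  have hJs : ContOnStrip τ J := ((hA₁.sub hA₂).mul hd).add ((hB₁.sub hz0).mul hdx)
  have hJz : ∀ s ∈ Icc 0 τ, ∀ x, R < |x| → J s x = 0 := fun s hs x hx => by
    simp only [hJ]
    rw [hdz s hs x hx, hdxz s hs x hx]
    ring
  have hdd := hd.mul hd
  have hddz : ∀ s ∈ Icc 0 τ, ∀ x, R < |x| → (u s x - p s x) * (u s x - p s x) = 0 :=
    fun s hs x hx => by rw [hdz s hs x hx, mul_zero]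
  obtain ⟨g, hg, hgood⟩ := (H.2 τ hτ0 hτ).2
  have hE0 : ∫ x, (u 0 x - p 0 x) * (u 0 x - p 0 x) = 0 := by simp [h0]
  have hE : ∀ t ∈ Icc 0 τ, ∫ x, (u t x - p t x) * (u t x - p t x) = 0 := by
    refine eq_zero_of_integral_le (hdd.continuousOn_integral hddz)
      (fun s hs => integral_nonneg fun x => mul_self_nonneg _)
      (e := fun s => 2 * ∫ x, J s x)
      (continuousOn_const.mul (hJs.continuousOn_integral hJz))
      (fun t ht => by rw [hen t ht, hE0, zero_add])
      (k := fun s => C + 1 / 2 * g s) ?_ ?_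
    · exact (integrableOn_const (C := C) measure_Icc_lt_top.ne).add (hg.const_mul _)
    filter_upwards [hgood, ae_restrict_mem measurableSet_Ioc] with s hs hsm
    have hs' : s ∈ Icc 0 τ := ⟨hsm.1.le, hsm.2⟩
    have iJ : Integrable (J s) := integrable_of_forall_lt_abs (hJs.continuous hs') (hJz s hs')
    have idd : Integrable fun x => (u s x - p s x) * (u s x - p s x) :=
      integrable_of_forall_lt_abs (hdd.continuous hs') (hddz s hs')
    have iw : Integrable fun x => deriv (deriv (u s)) x * ((u s x - p s x) * (u s x - p s x)) :=
      idd.bdd_mul (measurable_deriv _).aestronglyMeasurable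
        (.of_forall fun x => (hs.2 x : ‖_‖ ≤ g s))
    set Q : ℝ → ℝ → ℝ := fun s x => -(deriv (u s) x * (u s x - p s x) * p₁ s x)
      - u s x * (deriv (u s) x - p₁ s x) * p₁ s x - u s x * (u s x - p s x) * p₂ s x
      - deriv (u s) x * (u s x - p s x) * (deriv (u s) x - p₁ s x) with hQ
    have cu := hus.continuous hs'
    have cV := hVs.continuous hs'
    have cp := hp.continuous hs'
    have cp₁ := hp₁.continuous hs'
    have cp₂ := hp₂.continuous hs'
    have iQ : Integrable (Q s) := by
      refine integrable_of_forall_lt_abs (A := R) (by simp only [hQ]; fun_prop) fun x hx => ?_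
      simp only [hQ]
      rw [hdz s hs' x hx, hdxz s hs' x hx]
      ring
    have iΨ : Integrable fun x => -(u s x * (u s x - p s x) * p₁ s x)
        - 1 / 2 * (deriv (u s) x * ((u s x - p s x) * (u s x - p s x))) := by
      refine integrable_of_forall_lt_abs (A := R) (by fun_prop) fun x hx => ?_
      rw [hdz s hs' x hx]
      ring
    have hΨ : ∀ x, HasDerivAt (fun x => -(u s x * (u s x - p s x) * p₁ s x)
        - 1 / 2 * (deriv (u s) x * ((u s x - p s x) * (u s x - p s x))))
        (Q s x - 1 / 2 * (deriv (deriv (u s)) x * ((u s x - p s x) * (u s x - p s x)))) x := by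
      intro x
      have a := H.hasDerivAt (hsub hs') x
      have a' := hddx s hs' x
      refine (((a.fun_mul a').fun_mul (hd₂ s hs' x)).fun_neg.fun_sub
        (((hs.1 x).2.hasDerivAt.fun_mul (a'.fun_mul a')).const_mul (1 / 2))).congr_deriv ?_
      simp only [hQ]
      ring
    have hzero := integral_eq_zero_of_hasDerivAt_of_integrable hΨ (iQ.sub (iw.const_mul _)) iΨ
    rw [integral_sub iQ (iw.const_mul _), integral_const_mul] at hzero
    have hmono : ∫ x, (2 * J s x - Q s x) ≤ ∫ x, C * ((u s x - p s x) * (u s x - p s x)) := by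
      refine integral_mono ((iJ.const_mul _).sub iQ) (idd.const_mul _) fun x => ?_
      have h1 : 2 * J s x - Q s x = p₂ s x * ((u s x - p s x) * (u s x - p s x))
          - u s x * ((deriv (u s) x - p₁ s x) * (deriv (u s) x - p₁ s x)) := by
        simp only [hJ, hQ]
        ring
      have h2 := mul_le_mul_of_nonneg_right ((le_abs_self _).trans (hC s hs' x))
        (mul_self_nonneg (u s x - p s x))
      have h3 := mul_nonneg (H.1.1 s (hsub hs') x) (mul_self_nonneg (deriv (u s) x - p₁ s x))
      simp only [h1]
      linarith
    have hmono' : ∫ x, deriv (deriv (u s)) x * ((u s x - p s x) * (u s x - p s x))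
        ≤ ∫ x, g s * ((u s x - p s x) * (u s x - p s x)) := by
      refine integral_mono iw (idd.const_mul _) fun x => ?_
      exact mul_le_mul_of_nonneg_right ((le_abs_self _).trans (hs.2 x)) (mul_self_nonneg _)
    rw [integral_sub (iJ.const_mul _) iQ, integral_const_mul, integral_const_mul] at hmono
    rw [integral_const_mul] at hmono'
    linarith
  by_contra hne
  have hpos : 0 < ∫ x, (u t x - p t x) * (u t x - p t x) := by
    refine (hdd.continuous ht).integral_pos_of_hasCompactSupport_nonneg_nonzero
      (HasCompactSupport.intro (isCompact_Icc (a := -R) (b := R)) fun x hx =>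
        hddz t ht x (notMem_Icc_neg.1 hx)) (fun x => mul_self_nonneg _) (x := x₀) ?_
    exact mul_self_ne_zero.2 (sub_ne_zero.2 hne)
  exact hpos.ne' (hE t ht)

section Convergence

variable {𝒰 : Ultrafilter ℕ} {h : ℕ → ℝ} {T τ R t : ℝ} {z : ℕ → ℝ → ℤ → ℝ} {B : ℕ → ℝ}
  {u : ℝ → ℝ → ℝ}

/-- As long as the lattice flows stay bounded, their limit is the strong solution. -/
lemma BoundedFlows.eq_flowLim (H : BoundedFlows 𝒰 h τ R z t B) (hu : IsStrongSolution T u)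
    (ht : t < T) (hc : Continuous (u 0)) (hR : ∀ x, R < |x| → u 0 x = 0)
    (h0 : ∀ N (i : ℤ), z N 0 i = u 0 (i * h N)) :
    ∀ s ∈ Icc 0 t, ∀ x, u s x = flowLim 𝒰 h z 0 s x := by
  refine hu.eq_of_classical (R := R) (C := B 2) (L := rateLip B (rateBound B) 0) ht hR
    (H.continuousOn 0) (H.continuousOn 1) (H.continuousOn 2)
    (fun s hs x => H.hasDerivAt_space 0 hs x) (fun s hs x => H.hasDerivAt_space 1 hs x)
    (fun s hs x hx => H.eq_zero 0 hs hx) (fun s hs x => H.abs_le 2 hs x) ?_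
    (fun x => H.eq_initial hc h0 x)
  intro s hs r hr x
  have := H.time_taylor 0 hs hr x
  simpa [flowRate] using this

/-- The second difference quotients of the lattice flows are controlled by the second derivative
of the strong solution. -/
lemma BoundedFlows.deriv_deriv_eq (H : BoundedFlows 𝒰 h τ R z t B) (hu : IsStrongSolution T u)
    (ht : t < T) (hc : Continuous (u 0)) (hR : ∀ x, R < |x| → u 0 x = 0)
    (h0 : ∀ N (i : ℤ), z N 0 i = u 0 (i * h N)) {s : ℝ} (hs : s ∈ Icc 0 t) (x : ℝ) :
    deriv (deriv (u s)) x = flowLim 𝒰 h z 2 s x := by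
  have e0 : u s = flowLim 𝒰 h z 0 s := funext (H.eq_flowLim hu ht hc hR h0 s hs)
  have e1 : deriv (u s) = flowLim 𝒰 h z 1 s := by
    rw [e0]; exact funext fun y => (H.hasDerivAt_space 0 hs y).deriv
  rw [e1]
  exact (H.hasDerivAt_space 1 hs x).deriv

/-- A priori bound: while the lattice flows stay bounded, their third difference quotients are
controlled by the integral of the majorant of the second derivative of the strong solution. -/
lemma BoundedFlows.eventually_abs_three_le (H : BoundedFlows 𝒰 h τ R z t B)
    (hu : IsStrongSolution T u) (hτ : τ < T) (hc : Continuous (u 0))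
    (hR : ∀ x, R < |x| → u 0 x = 0) (h0 : ∀ N (i : ℤ), z N 0 i = u 0 (i * h N))
    {g : ℝ → ℝ} (hg : IntegrableOn g (Icc 0 τ))
    (hug : ∀ᵐ s ∂(volume.restrict (Ioc (0:ℝ) τ)), ∀ x, |deriv (deriv (u s)) x| ≤ g s) {b : ℝ}
    (hb : ∀ N i, |(fdq (h N))^[3] (z N 0) i| ≤ b) :
    ∀ᶠ N in 𝒰, ∀ s ∈ Icc 0 t, ∀ i, |(fdq (h N))^[3] (z N s) i| ≤
      b * Real.exp (17 * ∫ r in (0 : ℝ)..τ, (|g r| + 1)) := by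
  have hτ0 : 0 ≤ τ := H.mem.1.trans H.mem.2
  have hb0 : 0 ≤ b := (abs_nonneg _).trans (hb 0 0)
  filter_upwards [H.eventually_abs_le 2 one_pos] with N hN s hs i
  obtain ⟨K, hKc, hK, hKa⟩ := (H.flow N).exists_continuous_sup
  have hsτ : s ∈ Icc 0 τ := ⟨hs.1, hs.2.trans H.mem.2⟩
  refine ((H.flow N).abs_three_le_exp hsτ hKc hK (hb N) i).trans ?_
  refine mul_le_mul_of_nonneg_left (Real.exp_le_exp.2 ?_) hb0
  refine mul_le_mul_of_nonneg_left ?_ (by norm_num)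
  have hgi : IntegrableOn (fun r => |g r| + 1) (Icc 0 τ) :=
    (show IntegrableOn (fun r => |g r|) (Icc 0 τ) volume from hg.abs).add
      (continuousOn_const.integrableOn_Icc)
  have hgτ : IntervalIntegrable (fun r => |g r| + 1) volume 0 τ :=
    (intervalIntegrable_iff_integrableOn_Icc_of_le hτ0).2 hgi
  have hgs : IntervalIntegrable (fun r => |g r| + 1) volume 0 s :=
    (intervalIntegrable_iff_integrableOn_Icc_of_le hs.1).2
      (hgi.mono_set (Icc_subset_Icc_right hsτ.2))
  have hKs : IntervalIntegrable K volume 0 s :=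
    (hKc.mono (Icc_subset_Icc_right hsτ.2)).intervalIntegrable_of_Icc hs.1
  refine (intervalIntegral.integral_mono_ae_restrict hs.1 hKs hgs ?_).trans
    (intervalIntegral.integral_mono_interval le_rfl hs.1 hsτ.2
      (Eventually.of_forall fun r => by positivity) hgτ)
  have hug' : ∀ᵐ r ∂(volume.restrict (Icc (0:ℝ) s)), ∀ x, |deriv (deriv (u r)) x| ≤ g r := by
    rw [← Measure.restrict_congr_set Ioc_ae_eq_Icc]
    exact ae_restrict_of_ae_restrict_of_subset (Ioc_subset_Ioc_right hsτ.2) hug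
  filter_upwards [hug', ae_restrict_mem measurableSet_Icc] with r hr hrs
  obtain ⟨j, hj⟩ := hKa r
  have hrt : r ∈ Icc 0 t := ⟨hrs.1, hrs.2.trans hs.2⟩
  have h1 := hN r hrt j
  have h2 := hr (j * h N)
  rw [H.deriv_deriv_eq hu (H.mem.2.trans_lt hτ) hc hR h0 hrt] at h2
  rw [hj]
  linarith [le_abs_self (g r)]

/-- The lattice flows approximating a strong solution stay bounded on the whole time interval. -/
lemma exists_boundedFlows (hh : ∀ N, LatticeFlow (h N) τ R (z N)) (hmesh : Tendsto h 𝒰 (𝓝 0))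
    (hτ0 : 0 ≤ τ) (hu : IsStrongSolution T u) (hτ : τ < T) (hc : Continuous (u 0))
    (hR : ∀ x, R < |x| → u 0 x = 0) (h0 : ∀ N (i : ℤ), z N 0 i = u 0 (i * h N))
    {g : ℝ → ℝ} (hg : IntegrableOn g (Icc 0 τ))
    (hug : ∀ᵐ s ∂(volume.restrict (Ioc (0:ℝ) τ)), ∀ x, |deriv (deriv (u s)) x| ≤ g s)
    {b : ℕ → ℝ} (hb : ∀ N n i, |(fdq (h N))^[n] (z N 0) i| ≤ b n) :
    ∃ B, BoundedFlows 𝒰 h τ R z τ B := by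
  have hR0 : 0 ≤ R := (hh 0).R_nonneg
  have hb3 : 0 ≤ b 3 := (abs_nonneg _).trans (hb 0 3 0)
  set E := Real.exp (17 * ∫ r in (0 : ℝ)..τ, (|g r| + 1)) with hE
  have hE1 : 1 ≤ E := by
    refine Real.one_le_exp (mul_nonneg (by norm_num) ?_)
    exact intervalIntegral.integral_nonneg hτ0 fun r _ => by positivity
  set M := (b 3 + 1) * E with hM
  have hM0 : 0 < M := by positivity
  have hbM : b 3 ≤ M := by nlinarith
  have hMe : M ≤ M * Real.exp 1 :=
    le_mul_of_one_le_right hM0.le (Real.one_le_exp zero_le_one)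
  obtain ⟨B, hB⟩ := LatticeFlow.exists_bounds R τ (M * Real.exp 1) b
  have hc0 : 0 < 17 * (2 * R + 5) * (M * Real.exp 1) := by positivity
  obtain ⟨δ, hδ, hδM⟩ : ∃ δ > 0, 17 * (2 * R + 5) * (M * Real.exp 1) * δ < 1 := by
    refine ⟨1 / (2 * (17 * (2 * R + 5) * (M * Real.exp 1))), by positivity, ?_⟩
    generalize 17 * (2 * R + 5) * (M * Real.exp 1) = c at hc0
    have : c * (1 / (2 * c)) = 1 / 2 := by field_simp
    rw [this]; norm_num
  have bdd : ∀ t ∈ Icc 0 τ, (∀ᶠ N in (𝒰 : Filter ℕ), ∀ s ∈ Icc 0 t, ∀ i,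
      |(fdq (h N))^[3] (z N s) i| ≤ M * Real.exp 1) → BoundedFlows 𝒰 h τ R z t B :=
    fun t ht hS => ⟨hh, hmesh, ht, hS.mono fun N hN => by
      intro n s hs i
      exact hB (h N) (z N) (hh N) (hb N) t ht hN n s hs i⟩
  have step : ∀ k : ℕ, ∀ᶠ N in (𝒰 : Filter ℕ), ∀ s ∈ Icc 0 (min (k * δ) τ), ∀ i,
      |(fdq (h N))^[3] (z N s) i| ≤ M * Real.exp 1 := by
    intro k
    induction k with
    | zero =>
      refine Eventually.of_forall fun N s hs i => ?_
      have : s = 0 := le_antisymm (hs.2.trans (by simp)) hs.1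
      rw [this]
      exact (hb N 3 i).trans (hbM.trans hMe)
    | succ k ih =>
      have ht : min (k * δ) τ ∈ Icc 0 τ := ⟨le_min (by positivity) hτ0, min_le_right _ _⟩
      filter_upwards [(bdd _ ht ih).eventually_abs_three_le hu hτ hc hR h0 hg hug
        (fun N i => hb N 3 i), ih] with N hN hN' s hs i
      rcases le_total s (min (k * δ) τ) with hsk | hsk
      · exact hN' s ⟨hs.1, hsk⟩ i
      · refine (hh N).abs_three_extend ht.1 hM0 hδ hδM (fun j => ?_) s ⟨hsk, ?_⟩ i
        · refine (hN _ ⟨ht.1, le_rfl⟩ j).trans ?_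
          rw [hM]; gcongr; linarith
        · refine hs.2.trans ?_
          push_cast
          rcases le_total (k * δ) τ with hk | hk
          · rw [min_eq_left hk, add_mul, one_mul]
          · rw [min_eq_right hk]
            exact (min_le_right _ _).trans (le_min (by linarith) le_rfl)
  obtain ⟨k, hk⟩ := exists_nat_ge (τ / δ)
  have hS := step k
  rw [min_eq_right ((div_le_iff₀ hδ).1 hk)] at hS
  exact ⟨B, bdd τ ⟨hτ0, le_rfl⟩ hS⟩

end Convergence

lemma finite_setOf_abs_mul_le {h : ℝ} (hh : 0 < h) (R : ℝ) : {i : ℤ | |i * h| ≤ R}.Finite := by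
  refine (finite_Icc (-⌈R / h⌉) ⌈R / h⌉).subset fun i hi => ?_
  rw [Set.mem_ofPred_eq, abs_le] at hi
  have h1 : (i : ℝ) ≤ R / h := (le_div_iff₀ hh).2 hi.2
  have h2 : -(i : ℝ) ≤ R / h := (le_div_iff₀ hh).2 (by linarith [hi.1])
  have h3 := Int.le_ceil (R / h)
  have h4 : (i : ℝ) ≤ ⌈R / h⌉ := h1.trans h3
  have h5 : (-i : ℝ) ≤ ⌈R / h⌉ := h2.trans h3
  constructor
  · rw [neg_le]; exact_mod_cast h5
  · exact_mod_cast h4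

/-- Smooth compactly supported data generate lattice flows at every mesh size. -/
lemma exists_latticeFlow {f : ℝ → ℝ} {R τ M h : ℝ} (hR0 : 0 ≤ R) (hR : ∀ x, R < |x| → f x = 0)
    (hf0 : ∀ x, 0 ≤ f x) (hM : ∀ x, f x ≤ M) (hτ : 0 ≤ τ) (hh : 0 < h) (hh1 : h ≤ 1) :
    ∃ z, LatticeFlow h τ R z ∧ ∀ i : ℤ, z 0 i = f (i * h) := by
  have hfin := finite_setOf_abs_mul_le hh R
  have hout : ∀ i : ℤ, i ∉ hfin.toFinset ↔ R < |i * h| := fun i => by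
    rw [Set.Finite.mem_toFinset, Set.mem_ofPred_eq, not_le]
  obtain ⟨z, hz0, hzs, hzb, hsol⟩ := exists_latticeSol hh ((hf0 0).trans (hM 0)) hτ hfin.toFinset
    (fun i : ℤ => f (i * h)) (fun i hi => hR _ ((hout i).1 hi)) (fun i => hf0 _) (fun i => hM _)
  exact ⟨z, ⟨hh, hh1, hR0, hsol, fun t ht i => (hzb t ht i).1,
    fun t i hi => hzs t i ((hout i).2 hi)⟩, fun i => congrFun hz0 i⟩

/-- Smoothness of a strong solution on compact time intervals. -/
lemma IsStrongSolution.contDiffOn_Icc {T τ : ℝ} {u : ℝ → ℝ → ℝ} (hu : IsStrongSolution T u)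
    (hsm : ContDiff ℝ (⊤ : ℕ∞) (u 0)) (hcs : HasCompactSupport (u 0)) (hτ0 : 0 < τ)
    (hτ : τ < T) :
    ContDiffOn ℝ (⊤ : ℕ∞) (Function.uncurry u) (Icc 0 τ ×ˢ (univ : Set ℝ)) := by
  obtain ⟨g, hg, hug⟩ := (hu.2 τ hτ0 hτ).2
  obtain ⟨R, hR0, hR⟩ := hcs.exists_forall_lt_abs
  have hb : ∀ n, ∃ b, ∀ x, |iteratedDeriv n (u 0) x| ≤ b := fun n => by
    have hn : HasCompactSupport (iteratedDeriv n (u 0)) := by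
      rw [iteratedDeriv_eq_iterate]
      induction n with
      | zero => exact hcs
      | succ n ih =>
        rw [Function.iterate_succ_apply']
        exact ih.deriv
    obtain ⟨b, hb⟩ := hn.exists_bound_of_continuous
      (hsm.continuous_iteratedDeriv n (by exact_mod_cast le_top))
    exact ⟨b, hb⟩
  choose b hb using hb
  have hM : ∀ x, u 0 x ≤ b 0 := fun x => by
    have := hb 0 x
    rw [iteratedDeriv_zero] at this
    exact (le_abs_self _).trans this
  set h : ℕ → ℝ := fun N => 1 / ((N : ℝ) + 1) with hh
  have hpos : ∀ N, 0 < h N := fun N => Nat.one_div_pos_of_nat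
  have hle : ∀ N, h N ≤ 1 := fun N => by
    rw [hh]
    exact (div_le_one (by positivity)).2 (by linarith [Nat.cast_nonneg (α := ℝ) N])
  have hmesh : Tendsto h (hyperfilter ℕ : Ultrafilter ℕ) (𝓝 0) :=
    tendsto_one_div_add_atTop_nhds_zero_nat.mono_left Nat.hyperfilter_le_atTop
  choose z hz hz0 using fun N => exists_latticeFlow hR0.le hR
    (hu.1.1 0 ⟨le_rfl, hτ0.trans hτ⟩) hM hτ0.le (hpos N) (hle N)
  obtain ⟨B, H⟩ := exists_boundedFlows (b := b) hz hmesh hτ0.le hu hτ hsm.continuous hR hz0 hg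
    (hug.mono fun s hs => hs.2) fun N n i => by
      rw [show z N 0 = fun j : ℤ => u 0 (j * h N) from funext (hz0 N)]
      exact abs_fdq_iterate_le_of_abs_iteratedDeriv_le (hpos N) n
        (hsm.of_le (by exact_mod_cast le_top)) (hb n) i
  refine (H.contDiffOn hτ0 0).congr ?_
  rintro ⟨s, x⟩ hsx
  exact H.eq_flowLim hu hτ hsm.continuous hR hz0 s hsx.1 x

end Auxiliary

/-- A strong solution on `[0,T̄)` with smooth, compactly supported
initial data is infinitely differentiable on `[0,T̄) × ℝ`. -/
theorem strong_solution_smooth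
    (T : ℝ) (u : ℝ → ℝ → ℝ) (hu : IsStrongSolution T u)
    (hsm : ContDiff ℝ (⊤ : ℕ∞) (u 0)) (hcs : HasCompactSupport (u 0)) :
    ContDiffOn ℝ (⊤ : ℕ∞) (Function.uncurry u) (Ico (0:ℝ) T ×ˢ (univ : Set ℝ)) := by
  rintro ⟨t, x⟩ ⟨ht, -⟩
  obtain ⟨τ, htτ, hτ⟩ := exists_between ht.2
  refine (hu.contDiffOn_Icc hsm hcs (ht.1.trans_lt htτ) hτ (t, x)
    ⟨⟨ht.1, htτ.le⟩, mem_univ x⟩).mono_of_mem_nhdsWithin ?_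
  have : Iio τ ×ˢ (univ : Set ℝ) ∈ nhds (t, x) :=
    prod_mem_nhds (Iio_mem_nhds htτ) univ_mem
  filter_upwards [mem_nhdsWithin_of_mem_nhds this, self_mem_nhdsWithin] with y hy hy'
  exact ⟨⟨hy'.1.1, hy.1.le⟩, mem_univ _⟩
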